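/- Let s ∈ (1/2, 1] and let η be a C^∞ function supported in [1/2,2] with η(t) = 1 − η(t/2) for all 1 ≤ t ≤ 2; for k ≥ 2 set η^k(t) = η(2^k(t−1)). There exists a constant C, depending only on η and s, such that for all coprime integers p, q with q ≥ 1, all integers N ≥ q and all 0 < h ≤ 1, there exist nonnegative reals (γ_k)_{k≥2} with Σ_{k≥2} γ_k ≤ C such that for every k ≥ 2: |F^{η^k}_{s,N}(p/q + h) − (θ_0 N^{1−s}/√q) ∫_ℝ e^{2πi N² h t²} t^{−s} η^k(t) dt − G^{η^k}_{s,N}(h)| ≤ C (√q N^{−s} + N^{1/2−s} γ_k). -/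

import Mathlib

open MeasureTheory Filter Set
open scoped Real BigOperators ENNReal

/-- The Gauss sum `τ_m = ∑_{b=0}^{q-1} e^{2πi (p b² + m b)/q}`. -/
noncomputable def gaussTau (p : ℤ) (q : ℕ) (m : ℤ) : ℂ :=
  ∑ b ∈ Finset.range q,
    Complex.exp (2 * Real.pi * Complex.I * ((p : ℂ) * (b : ℂ) ^ 2 + (m : ℂ) * (b : ℂ)) / (q : ℂ))

/-- `θ_m = τ_m / √q`. -/
noncomputable def gaussTheta (p : ℤ) (q : ℕ) (m : ℤ) : ℂ :=
  gaussTau p q m / (Real.sqrt q : ℂ)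

/-- `F^φ_{s,N}(x) = ∑_{n ≥ 1} n^{-s} e^{2πi n² x} φ(n/N)`. -/
noncomputable def FphiN (s : ℝ) (φ : ℝ → ℂ) (N : ℕ) (x : ℝ) : ℂ :=
  ∑' n : ℕ, (((((n : ℝ) + 1) ^ (-s) : ℝ)) : ℂ) *
    Complex.exp (2 * Real.pi * Complex.I * ((n : ℂ) + 1) ^ 2 * (x : ℂ)) *
    φ (((n : ℝ) + 1) / N)

/-- `G^φ_{s,N}(h) = (2hq)^{s-1/2} e^{iπ/4} ∑_{m ≥ 1} (θ_m/m^s) e^{-iπm²/(2q²h)} φ(m/(2Nhq))`. -/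
noncomputable def GphiN (s : ℝ) (φ : ℝ → ℂ) (p : ℤ) (q : ℕ) (N : ℕ) (h : ℝ) : ℂ :=
  (((2 * h * q) ^ (s - 1/2) : ℝ) : ℂ) * Complex.exp (Complex.I * Real.pi / 4) *
    ∑' m : ℕ, gaussTheta p q (m + 1) * (((((m : ℝ) + 1) ^ (-s) : ℝ)) : ℂ) *
      Complex.exp (-(Complex.I * Real.pi * ((m : ℂ) + 1) ^ 2 / (2 * (q : ℂ) ^ 2 * (h : ℂ)))) *
      φ (((m : ℝ) + 1) / (2 * N * h * q))


/-- A bump profile used for geometric sums. -/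
noncomputable def gmin (x : ℝ) : ℝ := min x (1 / x)

lemma gmin_nonneg {x : ℝ} (hx : 0 < x) : 0 ≤ gmin x := le_min hx.le (by positivity)

noncomputable def gminF (y : ℝ) : ℝ := if 1 ≤ y then 2 / y else 4 - 2 * y

lemma gminF_step {y : ℝ} (hy : 0 < y) : gmin y + gminF (2 * y) ≤ gminF y := by
  unfold gminF gmin
  by_cases h1 : 1 ≤ y
  · rw [if_pos (by linarith), if_pos h1]
    have : min y (1 / y) ≤ 1 / y := min_le_right _ _
    have h2 : 2 / (2 * y) = 1 / y := by field_simp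
    have h3 : 2 / y = 1 / y + 1 / y := by ring
    linarith
  · push Not at h1
    have hm : min y (1 / y) ≤ y := min_le_left _ _
    by_cases h2 : 1 ≤ 2 * y
    · rw [if_pos h2, if_neg (by linarith)]
      have h3 : 2 / (2 * y) = 1 / y := by field_simp
      have h4 : 1 / y ≤ 4 - 3 * y := by
        rw [div_le_iff₀ hy]
        nlinarith
      linarith
    · rw [if_neg h2, if_neg (by linarith)]
      linarith

lemma gminF_nonneg {y : ℝ} (hy : 0 < y) : 0 ≤ gminF y := by
  unfold gminF
  split_ifs with h
  · positivity
  · linarith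

lemma gminF_le {y : ℝ} (hy : 0 < y) : gminF y ≤ 4 := by
  unfold gminF
  split_ifs with h
  · rw [div_le_iff₀ hy]; linarith
  · linarith

lemma gmin_sum_range (n : ℕ) : ∀ y : ℝ, 0 < y →
    ∑ k ∈ Finset.range n, gmin (2 ^ k * y) ≤ gminF y := by
  induction n with
  | zero => intro y hy; simpa using gminF_nonneg hy
  | succ n ih =>
    intro y hy
    rw [Finset.sum_range_succ']
    have h := ih (2 * y) (by positivity)
    have h2 := gminF_step hy
    have h3 : ∑ k ∈ Finset.range n, gmin (2 ^ (k + 1) * y) =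
        ∑ k ∈ Finset.range n, gmin (2 ^ k * (2 * y)) := by
      refine Finset.sum_congr rfl fun k _ => ?_
      congr 1; ring
    rw [h3]
    simp only [pow_zero, one_mul]
    linarith

lemma gmin_summable {y : ℝ} (hy : 0 < y) : Summable (fun k : ℕ => gmin (2 ^ k * y)) :=
  summable_of_sum_range_le (fun k => gmin_nonneg (by positivity))
    (fun n => (gmin_sum_range n y hy).trans (gminF_le hy))

lemma gmin_tsum_le {y : ℝ} (hy : 0 < y) : ∑' k : ℕ, gmin (2 ^ k * y) ≤ 4 :=
  Real.tsum_le_of_sum_range_le (fun k => gmin_nonneg (by positivity))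
    (fun n => (gmin_sum_range n y hy).trans (gminF_le hy))

lemma zsum_range (y : ℝ) (hy : 0 < y) (n : ℕ) :
    ∑ j ∈ Finset.range n, 1 / (1 + (y * ((j : ℝ) + 1)) ^ 2) ≤
      2 / y - 2 / y * (1 / (1 + y * n)) := by
  induction n with
  | zero => simp
  | succ n ih =>
    rw [Finset.sum_range_succ]
    have hn : (0 : ℝ) ≤ n := Nat.cast_nonneg n
    have key : 1 / (1 + (y * ((n : ℝ) + 1)) ^ 2) ≤
        2 / y * (1 / (1 + y * n)) - 2 / y * (1 / (1 + y * ((n : ℝ) + 1))) := by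
      have e : 2 / y * (1 / (1 + y * n)) - 2 / y * (1 / (1 + y * ((n : ℝ) + 1))) =
          2 / ((1 + y * n) * (1 + y * ((n : ℝ) + 1))) := by
        field_simp; ring
      rw [e, div_le_div_iff₀ (by positivity) (by positivity)]
      have : 0 ≤ y * n := by positivity
      nlinarith [sq_nonneg (y * ((n : ℝ) + 1) - 1), mul_nonneg this hy.le]
    push_cast
    linarith

lemma zsum_nat (y : ℝ) (hy : 0 < y) :
    Summable (fun j : ℕ => 1 / (1 + (y * ((j : ℝ) + 1)) ^ 2)) ∧
      ∑' j : ℕ, 1 / (1 + (y * ((j : ℝ) + 1)) ^ 2) ≤ 2 / y := by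
  have h : ∀ n : ℕ, ∑ j ∈ Finset.range n, 1 / (1 + (y * ((j : ℝ) + 1)) ^ 2) ≤ 2 / y := by
    intro n
    have := zsum_range y hy n
    have h2 : 0 ≤ 2 / y * (1 / (1 + y * n)) := by positivity
    linarith
  exact ⟨summable_of_sum_range_le (fun k => by positivity) h,
    Real.tsum_le_of_sum_range_le (fun k => by positivity) h⟩

/-- Truncated lattice profile. -/
noncomputable def zprof (y : ℝ) (m : ℤ) : ℝ := if m = 0 then 0 else 1 / (1 + (y * m) ^ 2)

lemma zprof_sum (y : ℝ) (hy : 0 < y) :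
    Summable (zprof y) ∧ ∑' m : ℤ, zprof y m ≤ 4 / y := by
  obtain ⟨h1, h2⟩ := zsum_nat y hy
  have hA : HasSum (fun n : ℕ => zprof y ((n : ℤ) + 1))
      (∑' j : ℕ, 1 / (1 + (y * ((j : ℝ) + 1)) ^ 2)) := by
    convert h1.hasSum using 2 with n
    unfold zprof
    rw [if_neg (by omega)]
    push_cast; rfl
  have hB : HasSum (fun n : ℕ => zprof y (-((n : ℤ) + 1)))
      (∑' j : ℕ, 1 / (1 + (y * ((j : ℝ) + 1)) ^ 2)) := by
    convert h1.hasSum using 2 with n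
    unfold zprof
    rw [if_neg (by omega)]
    push_cast
    congr 2
    ring
  have hA' : HasSum (fun n : ℕ => zprof y (n : ℤ))
      (∑' j : ℕ, 1 / (1 + (y * ((j : ℝ) + 1)) ^ 2)) := by
    rw [← hasSum_nat_add_iff' 1]
    simpa [zprof] using hA
  have := HasSum.of_nat_of_neg_add_one hA' hB
  refine ⟨this.summable, ?_⟩
  rw [this.tsum_eq]
  have : 4 / y = 2 / y + 2 / y := by ring
  linarith


lemma card_two_torsion (q : ℕ) [NeZero q] :
    (Finset.univ.filter (fun d : ZMod q => 2 * d = 0)).card ≤ 2 := by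
  have : (Finset.univ.filter (fun d : ZMod q => 2 * d = 0)).card ≤ ({0, q / 2} : Finset ℕ).card := by
    apply Finset.card_le_card_of_injOn (fun d => d.val)
    · intro d hd
      simp only [Finset.coe_filter, Finset.mem_univ, true_and, Set.mem_setOf_eq] at hd
      have h2 : ((2 * d.val : ℕ) : ZMod q) = 0 := by
        push_cast
        rw [ZMod.natCast_zmod_val]; exact hd
      rw [ZMod.natCast_eq_zero_iff] at h2
      obtain ⟨c, hc⟩ := h2
      have hlt := d.val_lt
      have hc2 : c < 2 := by
        by_contra hcc
        push Not at hcc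
        have : q * 2 ≤ q * c := Nat.mul_le_mul_left q hcc
        omega
      simp only [Finset.coe_insert, Finset.coe_singleton, Set.mem_insert_iff, Set.mem_singleton_iff]
      interval_cases c
      · left; omega
      · right; omega
    · intro a _ b _ hab
      exact ZMod.val_injective q hab
  exact this.trans Finset.card_le_two

lemma gaussTau_eq_zmod (p : ℤ) (q : ℕ) [NeZero q] (m : ℤ) :
    gaussTau p q m = ∑ x : ZMod q, ZMod.stdAddChar ((p : ZMod q) * x ^ 2 + (m : ZMod q) * x) := by
  unfold gaussTau
  rw [← Equiv.sum_comp (ZMod.finEquiv q).toEquiv, ← Fin.sum_univ_eq_sum_range (fun b : ℕ =>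
    Complex.exp (2 * Real.pi * Complex.I * ((p : ℂ) * (b : ℂ) ^ 2 + (m : ℂ) * (b : ℂ)) / (q : ℂ)))]
  refine Finset.sum_congr rfl fun b _ => ?_
  have hb : (ZMod.finEquiv q).toEquiv b = (((b : ℕ) : ℤ) : ZMod q) := by
    obtain ⟨n, rfl⟩ : ∃ n, q = n + 1 := ⟨q - 1, by have := NeZero.ne q; omega⟩
    have : (ZMod.finEquiv (n+1)).toEquiv b = (b : ZMod (n+1)) := rfl
    rw [this]
    push_cast
    exact (Fin.cast_val_eq_self b).symm
  rw [hb]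
  have : (p : ZMod q) * (((b : ℕ) : ℤ) : ZMod q) ^ 2 + (m : ZMod q) * (((b : ℕ) : ℤ) : ZMod q)
    = ((p * ((b : ℕ) : ℤ) ^ 2 + m * ((b : ℕ) : ℤ) : ℤ) : ZMod q) := by push_cast; ring
  rw [this, ZMod.stdAddChar_coe]
  push_cast
  rfl

lemma gaussTau_norm_sq (p : ℤ) (q : ℕ) (hq : 1 ≤ q) (hpq : IsCoprime p (q : ℤ)) (m : ℤ) :
    ‖gaussTau p q m‖ ^ 2 ≤ 2 * q := by
  haveI : NeZero q := ⟨by omega⟩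
  have hpu : IsUnit (p : ZMod q) := by
    obtain ⟨a, b, hab⟩ := hpq
    refine IsUnit.of_mul_eq_one (a : ZMod q) ?_
    have := congrArg (fun z : ℤ => (z : ZMod q)) hab
    simp only [Int.cast_add, Int.cast_mul, Int.cast_natCast, ZMod.natCast_self, mul_zero, add_zero,
      Int.cast_one] at this
    rw [mul_comm]; exact this
  set χ : AddChar (ZMod q) ℂ := ZMod.stdAddChar with hχ
  have hprim : χ.IsPrimitive := ZMod.isPrimitive_stdAddChar q
  set f : ZMod q → ℂ := fun x => χ ((p : ZMod q) * x ^ 2 + (m : ZMod q) * x) with hf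
  have hconj : ∀ x, (starRingEnd ℂ) (χ x) = χ (-x) := fun x => (AddChar.map_neg_eq_conj χ x).symm
  have e1 : ((‖gaussTau p q m‖ ^ 2 : ℝ) : ℂ) =
      ∑ d : ZMod q, f d * ∑ y : ZMod q, χ (y * (2 * p * d)) := by
    rw [gaussTau_eq_zmod, Complex.ofReal_pow, ← Complex.mul_conj', map_sum, Finset.sum_mul_sum,
      Finset.sum_comm]
    simp_rw [Finset.mul_sum]
    rw [Finset.sum_comm (s := Finset.univ) (t := Finset.univ) (f := fun d y => f d * χ (y * (2 * p * d)))]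
    refine Finset.sum_congr rfl fun y _ => ?_
    rw [← Equiv.sum_comp (Equiv.addRight y)]
    refine Finset.sum_congr rfl fun d _ => ?_
    rw [← hχ, hconj, hf]
    simp only [Equiv.coe_addRight]
    rw [← AddChar.map_add_eq_mul, ← AddChar.map_add_eq_mul]
    congr 1
    ring
  have e2 : ∀ d : ZMod q, ‖f d * ∑ y : ZMod q, χ (y * (2 * p * d))‖ ≤
      if 2 * d = 0 then (q : ℝ) else 0 := by
    intro d
    rw [AddChar.sum_mulShift _ hprim, norm_mul]
    have : ‖f d‖ = 1 := AddChar.norm_apply _ _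
    rw [this, one_mul]
    have h3 : (2 * (p : ZMod q) * d = 0) ↔ 2 * d = 0 := by
      rw [show 2 * (p : ZMod q) * d = p * (2 * d) by ring]
      exact hpu.mul_right_eq_zero
    by_cases h : 2 * d = 0
    · rw [if_pos (h3.2 h), if_pos h, ZMod.card]; simp
    · rw [if_neg (fun hh => h (h3.1 hh)), if_neg h]; simp
  have e3 : ‖gaussTau p q m‖ ^ 2 = ‖∑ d : ZMod q, f d * ∑ y : ZMod q, χ (y * (2 * p * d))‖ := by
    rw [← e1, Complex.norm_real, Real.norm_of_nonneg (by positivity)]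
  rw [e3]
  refine (norm_sum_le _ _).trans ((Finset.sum_le_sum fun d _ => e2 d).trans ?_)
  rw [← Finset.sum_filter, Finset.sum_const, nsmul_eq_mul]
  have := card_two_torsion q
  have h4 : ((Finset.univ.filter (fun d : ZMod q => 2 * d = 0)).card : ℝ) ≤ 2 := by exact_mod_cast this
  exact mul_le_mul_of_nonneg_right h4 (Nat.cast_nonneg q)


/-- The Fresnel constant. -/
noncomputable def Kfr (ν : ℝ) : ℂ := ((1 / Real.sqrt (2 * ν) : ℝ) : ℂ) * Complex.exp (Complex.I * Real.pi / 4)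

lemma Kfr_eq (ν : ℝ) (hν : 0 < ν) : (Complex.I / (2 * ν)) ^ (1 / 2 : ℂ) = Kfr ν := by
  have h : Complex.I / (2 * (ν : ℂ)) = ((1 / (2 * ν) : ℝ) : ℂ) * Complex.I := by
    push_cast; ring
  have hr : (0 : ℝ) < 1 / (2 * ν) := by positivity
  have hs : ((1 / Real.sqrt (2 * ν) : ℝ) : ℂ) = Complex.exp ((Real.log (1 / (2 * ν)) : ℂ) * (1 / 2 : ℂ)) := by
    have : (1 / Real.sqrt (2 * ν) : ℝ) = Real.exp (Real.log (1 / (2 * ν)) * (1 / 2)) := by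
      rw [← Real.rpow_def_of_pos hr, ← Real.sqrt_eq_rpow, Real.sqrt_div zero_le_one, Real.sqrt_one]
    rw [this]; push_cast; rfl
  rw [h, Complex.cpow_def_of_ne_zero (mul_ne_zero (by exact_mod_cast hr.ne') Complex.I_ne_zero),
    Complex.log_ofReal_mul hr Complex.I_ne_zero, Complex.log_I, Kfr, hs, ← Complex.exp_add]
  congr 1; ring

lemma Kfr_norm (ν : ℝ) : ‖Kfr ν‖ = 1 / Real.sqrt (2 * ν) := by
  unfold Kfr
  rw [norm_mul, Complex.norm_real, Real.norm_of_nonneg (by positivity)]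
  have : Complex.I * Real.pi / 4 = ((Real.pi / 4 : ℝ) : ℂ) * Complex.I := by push_cast; ring
  rw [this, Complex.norm_exp_ofReal_mul_I, mul_one]

open FourierTransform in
lemma parseval_eps (a : ℝ → ℂ) (ha : Integrable a) (c : ℝ) (b : ℂ) (hb : 0 < b.re) :
    ∫ v : ℝ, a v * Complex.exp (-π / b * ((v : ℂ) - c) ^ 2) =
      b ^ (1 / 2 : ℂ) * ∫ ξ : ℝ, 𝓕 a ξ * Complex.exp (-π * b * (ξ : ℂ) ^ 2 + 2 * π * (Complex.I * c) * ξ) := by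
  have hb0 : b ≠ 0 := by rintro rfl; simp at hb
  have hbb : b ^ (1 / 2 : ℂ) ≠ 0 := by
    rw [Ne, Complex.cpow_eq_zero_iff]; tauto
  have hg : Integrable (fun ξ : ℝ => Complex.exp (-π * b * (ξ : ℂ) ^ 2 + 2 * π * (Complex.I * c) * ξ)) := by
    have h1 : (-(π : ℂ) * b).re < 0 := by
      have := mul_pos Real.pi_pos hb
      simpa using this
    simpa using integrable_cexp_quadratic' h1 (2 * π * (Complex.I * c)) 0
  have h := VectorFourier.integral_fourierIntegral_smul_eq_flip (μ := volume) (ν := volume)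
    (L := innerₗ ℝ) (e := Real.fourierChar) Real.continuous_fourierChar continuous_inner ha hg
  have h2 : ∫ ξ : ℝ, 𝓕 a ξ * Complex.exp (-π * b * (ξ : ℂ) ^ 2 + 2 * π * (Complex.I * c) * ξ) =
      ∫ v : ℝ, a v * 𝓕 (fun ξ : ℝ => Complex.exp (-π * b * (ξ : ℂ) ^ 2 + 2 * π * (Complex.I * c) * ξ)) v := by
    simpa using! h
  rw [h2, fourier_gaussian_pi' hb, ← integral_const_mul]
  refine integral_congr_ae (Eventually.of_forall fun v => ?_)
  simp only
  have : (v : ℂ) + Complex.I * (Complex.I * c) = v - c := by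
    rw [← mul_assoc, Complex.I_mul_I]; ring
  rw [this]
  field_simp

lemma norm_cexp_le_one_of_re {z : ℂ} (hz : z.re ≤ 0) : ‖Complex.exp z‖ ≤ 1 := by
  rw [Complex.norm_exp]; exact Real.exp_le_one_iff.2 hz

open FourierTransform Topology in
lemma parseval_fresnel (a : ℝ → ℂ) (ha : Integrable a) (hFa : Integrable (𝓕 a)) (c ν : ℝ) (hν : 0 < ν) :
    ∫ v : ℝ, a v * Complex.exp (2 * π * Complex.I * ν * ((v : ℂ) - c) ^ 2) =
      Kfr ν * ∫ ξ : ℝ, 𝓕 a ξ * Complex.exp (-π * (Complex.I / (2 * ν)) * (ξ : ℂ) ^ 2 + 2 * π * (Complex.I * c) * ξ) := by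
  set b : ℝ → ℂ := fun ε => (ε : ℂ) + Complex.I / (2 * ν) with hbdef
  have hbre : ∀ ε, (b ε).re = ε := by
    intro ε
    have : Complex.I / (2 * (ν : ℂ)) = ((1 / (2 * ν) : ℝ) : ℂ) * Complex.I := by
      push_cast; ring
    simp only [hbdef]
    rw [this]; simp
  have hb0 : b 0 = Complex.I / (2 * ν) := by simp [hbdef]
  have hbc : Continuous b := by fun_prop
  have hbt : Tendsto b (𝓝[>] 0) (𝓝 (Complex.I / (2 * ν))) := by
    rw [← hb0]; exact (hbc.tendsto 0).mono_left nhdsWithin_le_nhds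
  have hνc : (ν : ℂ) ≠ 0 := by exact_mod_cast hν.ne'
  have hI0 : Complex.I / (2 * (ν : ℂ)) ≠ 0 := div_ne_zero Complex.I_ne_zero (by simp [hνc])
  have hinv : -π / (Complex.I / (2 * (ν : ℂ))) = 2 * π * Complex.I * ν := by
    rw [div_div_eq_mul_div, div_eq_iff Complex.I_ne_zero]
    linear_combination (-2 * π * ν : ℂ) * Complex.I_mul_I
  have hL : Tendsto (fun ε => ∫ v : ℝ, a v * Complex.exp (-π / b ε * ((v : ℂ) - c) ^ 2)) (𝓝[>] 0)
      (𝓝 (∫ v : ℝ, a v * Complex.exp (2 * π * Complex.I * ν * ((v : ℂ) - c) ^ 2))) := by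
    refine tendsto_integral_filter_of_dominated_convergence (fun v => ‖a v‖) ?_ ?_ ha.norm ?_
    · refine Eventually.of_forall fun ε => ?_
      exact ha.aestronglyMeasurable.mul (by fun_prop : Continuous _).aestronglyMeasurable
    · filter_upwards [self_mem_nhdsWithin] with ε hε
      refine Eventually.of_forall fun v => ?_
      rw [norm_mul]
      refine mul_le_of_le_one_right (norm_nonneg _) (norm_cexp_le_one_of_re ?_)
      have hr : (-π / b ε * ((v : ℂ) - c) ^ 2) = ((π * (v - c) ^ 2 : ℝ) : ℂ) * (-(b ε)⁻¹) := by
        push_cast; rw [div_eq_mul_inv]; ring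
      rw [hr, Complex.re_ofReal_mul, Complex.neg_re, Complex.inv_re, hbre]
      have hε' : 0 < ε := hε
      have : 0 ≤ π * (v - c) ^ 2 * (ε / Complex.normSq (b ε)) := by
        have := Complex.normSq_nonneg (b ε)
        have := Real.pi_pos
        positivity
      linarith
    · refine Eventually.of_forall fun v => ?_
      refine Tendsto.const_mul _ ?_
      refine (Complex.continuous_exp.tendsto _).comp ?_
      refine Tendsto.mul_const _ ?_
      rw [← hinv]
      exact tendsto_const_nhds.div hbt hI0
  have hR : Tendsto (fun ε => b ε ^ (1 / 2 : ℂ) * ∫ ξ : ℝ, 𝓕 a ξ * Complex.exp (-π * b ε * (ξ : ℂ) ^ 2 + 2 * π * (Complex.I * c) * ξ)) (𝓝[>] 0)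
      (𝓝 (Kfr ν * ∫ ξ : ℝ, 𝓕 a ξ * Complex.exp (-π * (Complex.I / (2 * ν)) * (ξ : ℂ) ^ 2 + 2 * π * (Complex.I * c) * ξ))) := by
    refine Tendsto.mul ?_ ?_
    · rw [← Kfr_eq ν hν]
      have hsl : Complex.I / (2 * (ν : ℂ)) ∈ Complex.slitPlane := by
        right
        have : Complex.I / (2 * (ν : ℂ)) = ((1 / (2 * ν) : ℝ) : ℂ) * Complex.I := by
          push_cast; ring
        rw [this]
        simp [hν.ne']
      exact hbt.cpow tendsto_const_nhds hsl
    · refine tendsto_integral_filter_of_dominated_convergence (fun v => ‖𝓕 a v‖) ?_ ?_ hFa.norm ?_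
      · refine Eventually.of_forall fun ε => ?_
        exact hFa.aestronglyMeasurable.mul (by fun_prop : Continuous _).aestronglyMeasurable
      · filter_upwards [self_mem_nhdsWithin] with ε hε
        refine Eventually.of_forall fun v => ?_
        rw [norm_mul]
        refine mul_le_of_le_one_right (norm_nonneg _) (norm_cexp_le_one_of_re ?_)
        have hr : -π * b ε * (v : ℂ) ^ 2 + 2 * π * (Complex.I * c) * v =
            ((-π * v ^ 2 : ℝ) : ℂ) * b ε + ((2 * π * c * v : ℝ) : ℂ) * Complex.I := by
          push_cast; ring
        rw [hr, Complex.add_re, Complex.re_ofReal_mul, hbre, Complex.re_ofReal_mul, Complex.I_re]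
        have hε' : 0 < ε := hε
        have : 0 ≤ π * v ^ 2 * ε := by
          have := Real.pi_pos
          positivity
        linarith
      · refine Eventually.of_forall fun v => ?_
        refine Tendsto.const_mul _ ?_
        refine (Complex.continuous_exp.tendsto _).comp ?_
        refine Tendsto.add_const _ (Tendsto.mul_const _ (Tendsto.const_mul _ hbt))
  refine tendsto_nhds_unique hL (hR.congr' ?_)
  filter_upwards [self_mem_nhdsWithin] with ε hε
  rw [parseval_eps a ha c (b ε) (by rw [hbre]; exact hε)]


/-- Admissible amplitudes: smooth, supported in `[1/2,2]`, with derivatives up to order 3 bounded by `B`. -/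
structure Adm (B : ℝ) (a : ℝ → ℂ) : Prop where
  smooth : ContDiff ℝ (⊤ : ℕ∞) a
  supp : tsupport a ⊆ Set.Icc (1/2 : ℝ) 2
  bound : ∀ j ≤ 3, ∀ v, ‖iteratedDeriv j a v‖ ≤ B

/-- Stationary phase error. -/
noncomputable def Ism (a : ℝ → ℂ) (ν c : ℝ) : ℂ :=
  (∫ v : ℝ, a v * Complex.exp (2 * π * Complex.I * ν * ((v : ℂ) - c) ^ 2)) - Kfr ν * a c

namespace Adm

variable {B : ℝ} {a : ℝ → ℂ}

lemma B_nonneg (h : Adm B a) : 0 ≤ B := (norm_nonneg _).trans (h.bound 0 (by norm_num) 0)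

lemma compact (h : Adm B a) : HasCompactSupport a :=
  IsCompact.of_isClosed_subset isCompact_Icc (isClosed_tsupport _) h.supp

lemma tsupport_iter (h : Adm B a) (j : ℕ) : tsupport (iteratedDeriv j a) ⊆ Set.Icc (1/2 : ℝ) 2 := by
  refine subset_trans ?_ h.supp
  refine closure_minimal ?_ (isClosed_tsupport _)
  intro x hx
  by_contra hxs
  apply hx
  have h0 : a =ᶠ[nhds x] fun _ => (0 : ℂ) := notMem_tsupport_iff_eventuallyEq.1 hxs
  rw [(h0.iteratedDeriv_eq j)]
  simp

lemma iter_zero (h : Adm B a) (j : ℕ) {v : ℝ} (hv : v ∉ Set.Icc (1/2 : ℝ) 2) :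
    iteratedDeriv j a v = 0 := image_eq_zero_of_notMem_tsupport fun hh => hv (h.tsupport_iter j hh)

lemma zero (h : Adm B a) {v : ℝ} (hv : v ∉ Set.Icc (1/2 : ℝ) 2) : a v = 0 := by
  simpa using h.iter_zero 0 hv

lemma iter_cont (h : Adm B a) (j : ℕ) : Continuous (iteratedDeriv j a) :=
  h.smooth.continuous_iteratedDeriv j (by exact_mod_cast le_top)

lemma iter_compact (h : Adm B a) (j : ℕ) : HasCompactSupport (iteratedDeriv j a) :=
  IsCompact.of_isClosed_subset isCompact_Icc (isClosed_tsupport _) (h.tsupport_iter j)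

lemma iter_integrable (h : Adm B a) (j : ℕ) : Integrable (iteratedDeriv j a) :=
  (h.iter_cont j).integrable_of_hasCompactSupport (h.iter_compact j)

lemma norm_iter_integral (h : Adm B a) (j : ℕ) (hj : j ≤ 3) :
    ∫ v, ‖iteratedDeriv j a v‖ ≤ 2 * B := by
  have hB := h.B_nonneg
  have h1 : ∀ v, ‖iteratedDeriv j a v‖ ≤ (Set.Icc (1/2 : ℝ) 2).indicator (fun _ => B) v := by
    intro v
    by_cases hv : v ∈ Set.Icc (1/2 : ℝ) 2
    · rw [Set.indicator_of_mem hv]; exact h.bound j hj v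
    · rw [Set.indicator_of_notMem hv, h.iter_zero j hv, norm_zero]
  have h2 : Integrable ((Set.Icc (1/2 : ℝ) 2).indicator (fun _ : ℝ => B)) := by
    rw [integrable_indicator_iff measurableSet_Icc]
    exact integrableOn_const (by simp)
  calc ∫ v, ‖iteratedDeriv j a v‖ ≤ ∫ v, (Set.Icc (1/2 : ℝ) 2).indicator (fun _ => B) v :=
        integral_mono (h.iter_integrable j).norm h2 h1
    _ = (3 / 2) * B := by
        rw [integral_indicator measurableSet_Icc, setIntegral_const]
        simp only [smul_eq_mul, Measure.real, Real.volume_Icc]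
        rw [ENNReal.toReal_ofReal (by norm_num)]; norm_num
    _ ≤ 2 * B := by linarith

lemma integrable (h : Adm B a) : Integrable a := by simpa using h.iter_integrable 0

open FourierTransform in
lemma fourier_integrable (h : Adm B a) : Integrable (𝓕 a) := by
  have := (𝓕 (h.compact.toSchwartzMap h.smooth)).integrable (μ := volume)
  rw [SchwartzMap.fourier_coe] at this
  exact this

open FourierTransform in
lemma fourier_decay (h : Adm B a) (j : ℕ) (hj : j ≤ 3) (ξ : ℝ) : |ξ| ^ j * ‖𝓕 a ξ‖ ≤ 2 * B := by
  have h1 := Real.fourier_iteratedDeriv (N := ⊤) (n := j) h.smooth (fun n _ => h.iter_integrable n) le_top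
  have h2 : ‖𝓕 (iteratedDeriv j a) ξ‖ ≤ 2 * B :=
    (VectorFourier.norm_fourierIntegral_le_integral_norm _ _ _ _ _).trans (h.norm_iter_integral j hj)
  rw [h1] at h2
  simp only [norm_smul, norm_pow, norm_mul, Complex.norm_real, Complex.norm_I] at h2
  refine le_trans ?_ h2
  gcongr
  have : (1 : ℝ) ≤ ‖(2 : ℂ)‖ * ‖π‖ := by
    rw [Real.norm_of_nonneg Real.pi_pos.le]
    simp
    linarith [Real.pi_gt_three]
  rw [Real.norm_eq_abs ξ, mul_one]
  exact le_mul_of_one_le_left (abs_nonneg ξ) this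

open FourierTransform in
lemma fourier_decay' (h : Adm B a) (ξ : ℝ) : |ξ| * ‖𝓕 a ξ‖ ≤ 4 * B * (1 + ξ ^ 2)⁻¹ := by
  have h1 := h.fourier_decay 1 (by norm_num) ξ
  have h3 := h.fourier_decay 3 (by norm_num) ξ
  rw [← div_eq_mul_inv, le_div_iff₀ (by positivity)]
  have : |ξ| ^ 3 = |ξ| * ξ ^ 2 := by rw [← sq_abs ξ]; ring
  rw [this] at h3
  rw [pow_one] at h1
  linarith

lemma norm_cexp_sub_one (t : ℝ) (ht : 0 ≤ t) : ‖Complex.exp (-(t : ℂ) * Complex.I) - 1‖ ≤ Real.sqrt (2 * t) := by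
  have h1 : ‖Complex.exp (-(t : ℂ) * Complex.I) - 1‖ ≤ t := by
    have := Real.norm_exp_I_mul_ofReal_sub_one_le (x := -t)
    rw [Real.norm_eq_abs, abs_neg, abs_of_nonneg ht] at this
    rw [show -(t : ℂ) * Complex.I = Complex.I * ((-t : ℝ) : ℂ) by push_cast; ring]
    exact this
  have h2 : ‖Complex.exp (-(t : ℂ) * Complex.I) - 1‖ ≤ 2 := by
    refine (norm_sub_le _ _).trans ?_
    have : ‖Complex.exp (-(t : ℂ) * Complex.I)‖ = 1 := by
      have := Complex.norm_exp_ofReal_mul_I (-t)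
      simpa using this
    rw [this]; norm_num
  apply Real.le_sqrt_of_sq_le
  have h0 := norm_nonneg (Complex.exp (-(t : ℂ) * Complex.I) - 1)
  nlinarith

open FourierTransform in
lemma inversion (h : Adm B a) (c : ℝ) :
    a c = ∫ ξ : ℝ, 𝓕 a ξ * Complex.exp (2 * π * (Complex.I * c) * ξ) := by
  have h1 := congrFun (Continuous.fourierInv_fourier_eq h.smooth.continuous h.integrable h.fourier_integrable) c
  conv_lhs => rw [← h1]
  rw [Real.fourierInv_eq']
  refine integral_congr_ae (Eventually.of_forall fun ξ => ?_)
  simp only [smul_eq_mul]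
  rw [mul_comm]
  congr 2
  simp
  ring

open FourierTransform in
/-- Stationary phase: error `O(1/ν)`. -/
lemma Ism_le (h : Adm B a) (ν c : ℝ) (hν : 0 < ν) : ‖Ism a ν c‖ ≤ 32 * B / ν := by
  have hB := h.B_nonneg
  unfold Ism
  rw [parseval_fresnel a h.integrable h.fourier_integrable c ν hν, h.inversion c, ← mul_sub,
    ← integral_sub, norm_mul, Kfr_norm]
  rotate_left
  · refine h.fourier_integrable.mul_bdd (c := 1) (by fun_prop : Continuous _).aestronglyMeasurable
      (Eventually.of_forall fun ξ => norm_cexp_le_one_of_re ?_)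
    have : -π * (Complex.I / (2 * ν)) * (ξ : ℂ) ^ 2 + 2 * π * (Complex.I * c) * ξ =
      ((-π * (1 / (2 * ν)) * ξ ^ 2 + 2 * π * c * ξ : ℝ) : ℂ) * Complex.I := by push_cast; ring
    rw [this, Complex.re_ofReal_mul]; simp
  · refine h.fourier_integrable.mul_bdd (c := 1) (by fun_prop : Continuous _).aestronglyMeasurable
      (Eventually.of_forall fun ξ => norm_cexp_le_one_of_re ?_)
    have : 2 * π * (Complex.I * c) * ξ =
      ((2 * π * c * ξ : ℝ) : ℂ) * Complex.I := by push_cast; ring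
    rw [this, Complex.re_ofReal_mul]; simp
  have hpt : ∀ ξ : ℝ, ‖𝓕 a ξ * Complex.exp (-π * (Complex.I / (2 * ν)) * (ξ : ℂ) ^ 2 + 2 * π * (Complex.I * c) * ξ) -
      𝓕 a ξ * Complex.exp (2 * π * (Complex.I * c) * ξ)‖ ≤ 2 / Real.sqrt ν * (4 * B) * (1 + ξ ^ 2)⁻¹ := by
    intro ξ
    rw [Complex.exp_add, ← mul_sub, ← sub_one_mul, norm_mul, norm_mul]
    have e1 : ‖Complex.exp (2 * π * (Complex.I * c) * ξ)‖ ≤ 1 := by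
      apply norm_cexp_le_one_of_re
      have : 2 * π * (Complex.I * c) * ξ =
        ((2 * π * c * ξ : ℝ) : ℂ) * Complex.I := by push_cast; ring
      rw [this, Complex.re_ofReal_mul]; simp
    have e2 : ‖Complex.exp (-π * (Complex.I / (2 * ν)) * (ξ : ℂ) ^ 2) - 1‖ ≤ 2 / Real.sqrt ν * |ξ| := by
      have := norm_cexp_sub_one (π * ξ ^ 2 / (2 * ν)) (by have := Real.pi_pos; positivity)
      have e3 : -((π * ξ ^ 2 / (2 * ν) : ℝ) : ℂ) * Complex.I = -π * (Complex.I / (2 * ν)) * (ξ : ℂ) ^ 2 := by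
        push_cast; ring
      rw [e3] at this
      refine this.trans ?_
      apply Real.sqrt_le_iff.2
      refine ⟨by positivity, ?_⟩
      rw [mul_pow, div_pow, Real.sq_sqrt hν.le, sq_abs]
      have e4 : 2 * (π * ξ ^ 2 / (2 * ν)) = π * (ξ ^ 2 / ν) := by field_simp
      have e5 : (2 : ℝ) ^ 2 / ν * ξ ^ 2 = 4 * (ξ ^ 2 / ν) := by ring
      rw [e4, e5]
      exact mul_le_mul_of_nonneg_right Real.pi_le_four (by positivity)
    calc ‖𝓕 a ξ‖ * (‖Complex.exp (-π * (Complex.I / (2 * ν)) * (ξ : ℂ) ^ 2) - 1‖ * ‖Complex.exp (2 * π * (Complex.I * c) * ξ)‖)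
        ≤ ‖𝓕 a ξ‖ * (2 / Real.sqrt ν * |ξ| * 1) := by gcongr
      _ = 2 / Real.sqrt ν * (|ξ| * ‖𝓕 a ξ‖) := by ring
      _ ≤ 2 / Real.sqrt ν * (4 * B * (1 + ξ ^ 2)⁻¹) := by
          exact mul_le_mul_of_nonneg_left (h.fourier_decay' ξ) (by positivity)
      _ = _ := by ring
  have hintg := norm_integral_le_of_norm_le (integrable_inv_one_add_sq.const_mul (2 / Real.sqrt ν * (4 * B)))
    (Eventually.of_forall hpt)
  rw [integral_const_mul, integral_univ_inv_one_add_sq] at hintg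
  have hs : Real.sqrt ν ≤ Real.sqrt (2 * ν) := Real.sqrt_le_sqrt (by linarith)
  have hs0 : 0 < Real.sqrt ν := Real.sqrt_pos.2 hν
  calc _ ≤ 1 / Real.sqrt ν * (2 / Real.sqrt ν * (4 * B) * π) := by gcongr
    _ = 8 * B * π / (Real.sqrt ν * Real.sqrt ν) := by field_simp; ring
    _ = 8 * B * π / ν := by rw [Real.mul_self_sqrt hν.le]
    _ ≤ 32 * B / ν := by
        refine div_le_div_of_nonneg_right ?_ hν.le
        nlinarith [Real.pi_le_four]

end Adm


lemma ibp_step (u u' : ℝ → ℂ) (ν c : ℝ) (hν : 0 < ν)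
    (hc : ∀ v ∈ Set.uIcc (0 : ℝ) 3, v - c ≠ 0)
    (hu : ∀ v ∈ Set.uIcc (0 : ℝ) 3, HasDerivAt u (u' v) v)
    (hu' : ContinuousOn u' (Set.uIcc (0 : ℝ) 3)) (u0 : u 0 = 0) (u3 : u 3 = 0) :
    ∫ v in (0 : ℝ)..3, u v * Complex.exp (2 * π * Complex.I * ν * ((v : ℂ) - c) ^ 2) =
      -(1 / (4 * π * Complex.I * ν)) * ∫ v in (0 : ℝ)..3,
        (u' v / ((v : ℂ) - c) - u v / ((v : ℂ) - c) ^ 2) *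
          Complex.exp (2 * π * Complex.I * ν * ((v : ℂ) - c) ^ 2) := by
  have hcc : ∀ v ∈ Set.uIcc (0 : ℝ) 3, (v : ℂ) - c ≠ 0 := by
    intro v hv; exact_mod_cast hc v hv
  have hk : (4 * π * Complex.I * ν : ℂ) ≠ 0 := by
    have : (ν : ℂ) ≠ 0 := by exact_mod_cast hν.ne'
    simp [this, Real.pi_ne_zero]
  have hid : ∀ v : ℝ, HasDerivAt (fun v : ℝ => (v : ℂ) - c) 1 v := fun v =>
    (Complex.ofRealCLM.hasDerivAt (x := v)).sub_const _
  have hU : ∀ v ∈ Set.uIcc (0 : ℝ) 3, HasDerivAt (fun v : ℝ => u v / ((v : ℂ) - c))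
      (u' v / ((v : ℂ) - c) - u v / ((v : ℂ) - c) ^ 2) v := by
    intro v hv
    have := (hu v hv).fun_div (hid v) (hcc v hv)
    refine this.congr_deriv ?_
    have := hcc v hv
    field_simp
  have hV : ∀ v ∈ Set.uIcc (0 : ℝ) 3, HasDerivAt
      (fun v : ℝ => Complex.exp (2 * π * Complex.I * ν * ((v : ℂ) - c) ^ 2))
      ((4 * π * Complex.I * ν) * ((v : ℂ) - c) * Complex.exp (2 * π * Complex.I * ν * ((v : ℂ) - c) ^ 2)) v := by
    intro v hv
    have := (((hid v).fun_pow 2).const_mul (2 * π * Complex.I * ν)).cexp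
    refine this.congr_deriv ?_
    push_cast
    ring
  have hucont : ContinuousOn u (Set.uIcc (0 : ℝ) 3) := fun v hv => (hu v hv).continuousAt.continuousWithinAt
  have hlin : ContinuousOn (fun v : ℝ => (v : ℂ) - c) (Set.uIcc (0 : ℝ) 3) := by fun_prop
  have hU' : ContinuousOn (fun v : ℝ => u' v / ((v : ℂ) - c) - u v / ((v : ℂ) - c) ^ 2) (Set.uIcc (0 : ℝ) 3) :=
    (hu'.div hlin hcc).sub (hucont.div (hlin.pow 2) (fun v hv => pow_ne_zero 2 (hcc v hv)))
  have key := intervalIntegral.integral_mul_deriv_eq_deriv_mul hU hV hU'.intervalIntegrable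
    (by fun_prop : Continuous fun v : ℝ => (4 * π * Complex.I * ν) * ((v : ℂ) - c) * Complex.exp (2 * π * Complex.I * ν * ((v : ℂ) - c) ^ 2)).continuousOn.intervalIntegrable
  simp only [u0, u3, zero_div, zero_mul, sub_zero, zero_sub] at key
  have e1 : ∫ v in (0 : ℝ)..3, u v / ((v : ℂ) - c) * ((4 * π * Complex.I * ν) * ((v : ℂ) - c) * Complex.exp (2 * π * Complex.I * ν * ((v : ℂ) - c) ^ 2)) =
      (4 * π * Complex.I * ν) * ∫ v in (0 : ℝ)..3, u v * Complex.exp (2 * π * Complex.I * ν * ((v : ℂ) - c) ^ 2) := by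
    rw [← intervalIntegral.integral_const_mul]
    refine intervalIntegral.integral_congr fun v hv => ?_
    have := hcc v hv
    field_simp
  rw [e1] at key
  rw [neg_mul, ← mul_neg, ← key]
  rw [← mul_assoc, one_div, inv_mul_cancel₀ hk, one_mul]

namespace Adm

variable {B : ℝ} {a : ℝ → ℂ}

lemma hasDeriv (h : Adm B a) (j : ℕ) (v : ℝ) :
    HasDerivAt (iteratedDeriv j a) (iteratedDeriv (j + 1) a v) v := by
  rw [iteratedDeriv_succ]
  exact ((h.smooth.differentiable_iteratedDeriv j (by exact_mod_cast ENat.natCast_lt_top j)) v).hasDerivAt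

lemma integral_eq (h : Adm B a) (e : ℝ → ℂ) :
    ∫ v : ℝ, a v * e v = ∫ v in (0 : ℝ)..3, a v * e v := by
  rw [intervalIntegral.integral_of_le (by norm_num)]
  symm
  apply setIntegral_eq_integral_of_forall_compl_eq_zero
  intro v hv
  rw [h.zero, zero_mul]
  intro hv2
  exact hv ⟨by linarith [hv2.1], by linarith [hv2.2]⟩

lemma norm_osc (ν c v : ℝ) : ‖Complex.exp (2 * π * Complex.I * ν * ((v : ℂ) - c) ^ 2)‖ = 1 := by
  have : 2 * π * Complex.I * ν * ((v : ℂ) - c) ^ 2 = ((2 * π * ν * (v - c) ^ 2 : ℝ) : ℂ) * Complex.I := by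
    push_cast; ring
  rw [this, Complex.norm_exp_ofReal_mul_I]

lemma trivial_le (h : Adm B a) (ν c : ℝ) :
    ‖∫ v : ℝ, a v * Complex.exp (2 * π * Complex.I * ν * ((v : ℂ) - c) ^ 2)‖ ≤ 2 * B := by
  refine (norm_integral_le_integral_norm _).trans ?_
  have := h.norm_iter_integral 0 (by norm_num)
  simp only [iteratedDeriv_zero] at this
  refine le_trans (le_of_eq ?_) this
  refine integral_congr_ae (Eventually.of_forall fun v => ?_)
  simp only [norm_mul, norm_osc, mul_one]

/-- Non-stationary phase. -/
lemma far_le (h : Adm B a) (ν c : ℝ) (hν : 0 < ν) (hc4 : 4 ≤ |c|) :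
    ‖∫ v : ℝ, a v * Complex.exp (2 * π * Complex.I * ν * ((v : ℂ) - c) ^ 2)‖ ≤ 3 * B / (ν * c) ^ 2 := by
  have hB := h.B_nonneg
  have hdist : ∀ v ∈ Set.uIcc (0 : ℝ) 3, 1 ≤ |v - c| ∧ |c| / 4 ≤ |v - c| := by
    intro v hv
    rw [Set.uIcc_of_le (by norm_num)] at hv
    have h1 : |c| ≤ |v - c| + |v| := by
      have := abs_sub_abs_le_abs_sub c v
      rw [abs_sub_comm c v] at this; linarith
    have h2 : |v| ≤ 3 := abs_le.2 ⟨by linarith [hv.1], hv.2⟩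
    constructor <;> linarith
  have hc : ∀ v ∈ Set.uIcc (0 : ℝ) 3, v - c ≠ 0 := by
    intro v hv h0
    have := (hdist v hv).1
    rw [h0] at this; norm_num at this
  have hcc : ∀ v ∈ Set.uIcc (0 : ℝ) 3, (v : ℂ) - c ≠ 0 := by
    intro v hv; exact_mod_cast hc v hv
  have n0 : (0 : ℝ) ∉ Set.Icc (1/2 : ℝ) 2 := by simp
  have n3 : (3 : ℝ) ∉ Set.Icc (1/2 : ℝ) 2 := by norm_num
  set a1 := iteratedDeriv 1 a with ha1
  set a2 := iteratedDeriv 2 a with ha2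
  have d0 : ∀ v, HasDerivAt a (a1 v) v := by
    intro v; simpa [ha1] using h.hasDeriv 0 v
  have d1 : ∀ v, HasDerivAt a1 (a2 v) v := fun v => h.hasDeriv 1 v
  have hid : ∀ v : ℝ, HasDerivAt (fun v : ℝ => (v : ℂ) - c) 1 v := fun v =>
    (Complex.ofRealCLM.hasDerivAt (x := v)).sub_const _
  have c0 : Continuous a := h.smooth.continuous
  have c1 : Continuous a1 := h.iter_cont 1
  have c2 : Continuous a2 := h.iter_cont 2
  have hlin : ContinuousOn (fun v : ℝ => (v : ℂ) - c) (Set.uIcc (0 : ℝ) 3) := by fun_prop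
  rw [h.integral_eq, ibp_step a a1 ν c hν hc (fun v _ => d0 v) c1.continuousOn (h.zero n0) (h.zero n3)]
  set b1 : ℝ → ℂ := fun v => a1 v / ((v : ℂ) - c) - a v / ((v : ℂ) - c) ^ 2 with hb1
  set b1' : ℝ → ℂ := fun v => (a2 v * ((v : ℂ) - c) - a1 v * 1) / ((v : ℂ) - c) ^ 2 -
    (a1 v * ((v : ℂ) - c) ^ 2 - a v * (2 * ((v : ℂ) - c))) / (((v : ℂ) - c) ^ 2) ^ 2 with hb1'
  have db : ∀ v ∈ Set.uIcc (0 : ℝ) 3, HasDerivAt b1 (b1' v) v := by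
    intro v hv
    have e1 := (d1 v).fun_div (hid v) (hcc v hv)
    have e2 := (d0 v).fun_div ((hid v).fun_pow 2) (pow_ne_zero 2 (hcc v hv))
    refine (e1.fun_sub e2).congr_deriv ?_
    simp only [hb1']
    push_cast
    ring
  have cb : ContinuousOn b1' (Set.uIcc (0 : ℝ) 3) := by
    refine ContinuousOn.sub (ContinuousOn.div ?_ (hlin.pow 2) (fun v hv => pow_ne_zero 2 (hcc v hv)))
      (ContinuousOn.div ?_ ((hlin.pow 2).pow 2) (fun v hv => pow_ne_zero 2 (pow_ne_zero 2 (hcc v hv)))) <;> fun_prop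
  have z : ∀ x, x ∉ Set.Icc (1/2 : ℝ) 2 → b1 x = 0 := by
    intro x hx
    simp only [hb1, ha1, h.zero hx, h.iter_zero 1 hx, zero_div, sub_zero]
  rw [ibp_step b1 b1' ν c hν hc db cb (z _ n0) (z _ n3), ← mul_assoc, norm_mul]
  have hbound : ∀ v ∈ Set.uIoc (0 : ℝ) 3, ‖(b1' v / ((v : ℂ) - c) - b1 v / ((v : ℂ) - c) ^ 2) *
      Complex.exp (2 * π * Complex.I * ν * ((v : ℂ) - c) ^ 2)‖ ≤ 112 * B / c ^ 2 := by
    intro v hv'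
    have hv := Set.uIoc_subset_uIcc hv'
    rw [norm_mul, norm_osc, mul_one]
    obtain ⟨r1, r4⟩ := hdist v hv
    have hz := hcc v hv
    have hn : ‖(v : ℂ) - c‖ = |v - c| := by
      rw [← Complex.ofReal_sub, Complex.norm_real, Real.norm_eq_abs]
    set w := (v : ℂ) - c with hw
    have e : b1' v / w - b1 v / w ^ 2 =
      a2 v * (1 / w ^ 2) + (-3 * a1 v) * (1 / w ^ 3) + (3 * a v) * (1 / w ^ 4) := by
      simp only [hb1', hb1, ← hw]
      field_simp
      ring
    have hB0 : ‖a v‖ ≤ B := by simpa using h.bound 0 (by norm_num) v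
    have hB1 : ‖a1 v‖ ≤ B := h.bound 1 (by norm_num) v
    have hB2 : ‖a2 v‖ ≤ B := h.bound 2 (by norm_num) v
    have hwpos : (0 : ℝ) < ‖w‖ := norm_pos_iff.2 hz
    have hw1 : 1 ≤ ‖w‖ := by rw [hn]; exact r1
    have p2 : 1 / ‖w‖ ^ 2 ≤ 16 / c ^ 2 := by
      have hcpos : 0 < c ^ 2 := by rw [← sq_abs]; positivity
      rw [div_le_div_iff₀ (by positivity) hcpos, hn, ← sq_abs c]
      nlinarith [abs_nonneg c]
    have p3 : 1 / ‖w‖ ^ 3 ≤ 1 / ‖w‖ ^ 2 :=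
      one_div_le_one_div_of_le (by positivity) (pow_le_pow_right₀ hw1 (by norm_num))
    have p4 : 1 / ‖w‖ ^ 4 ≤ 1 / ‖w‖ ^ 2 :=
      one_div_le_one_div_of_le (by positivity) (pow_le_pow_right₀ hw1 (by norm_num))
    rw [e]
    calc _ ≤ ‖a2 v‖ * (1 / ‖w‖ ^ 2) + (3 * ‖a1 v‖) * (1 / ‖w‖ ^ 3) + (3 * ‖a v‖) * (1 / ‖w‖ ^ 4) := by
          refine (norm_add₃_le).trans ?_
          simp
      _ ≤ B * (16 / c ^ 2) + (3 * B) * (16 / c ^ 2) + (3 * B) * (16 / c ^ 2) := by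
          have q3 := p3.trans p2
          have q4 := p4.trans p2
          refine add_le_add (add_le_add ?_ ?_) ?_
          · exact mul_le_mul hB2 p2 (by positivity) hB
          · exact mul_le_mul (by linarith) q3 (by positivity) (by linarith)
          · exact mul_le_mul (by linarith) q4 (by positivity) (by linarith)
      _ = 112 * B / c ^ 2 := by ring
  have hI := intervalIntegral.norm_integral_le_of_norm_le_const hbound
  have hpre : ‖-(1 / (4 * π * Complex.I * ν)) * -(1 / (4 * π * Complex.I * (ν : ℂ)))‖ ≤ 1 / (144 * ν ^ 2) := by
    have e0 : ‖-(1 / (4 * π * Complex.I * (ν : ℂ)))‖ = 1 / (4 * π * ν) := by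
      simp only [norm_mul, norm_neg, norm_div, Complex.norm_real, Complex.norm_I, norm_one, mul_one,
        Real.norm_of_nonneg Real.pi_pos.le, Real.norm_of_nonneg hν.le]
      simp
    rw [norm_mul, e0, one_div_mul_one_div]
    apply one_div_le_one_div_of_le (by positivity)
    have h3 : 12 * ν ≤ 4 * π * ν := by nlinarith [Real.pi_gt_three]
    calc 144 * ν ^ 2 = (12 * ν) * (12 * ν) := by ring
      _ ≤ _ := mul_le_mul h3 h3 (by positivity) (by positivity)
  refine (mul_le_mul hpre hI (norm_nonneg _) (by positivity)).trans ?_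
  have hc0 : c ≠ 0 := by rintro rfl; norm_num at hc4
  have e : 1 / (144 * ν ^ 2) * (112 * B / c ^ 2 * |(3 : ℝ) - 0|) = (336 / 144) * (B / (ν * c) ^ 2) := by
    norm_num
    field_simp
    ring
  rw [e, mul_div_assoc]
  gcongr
  norm_num

end Adm


namespace Adm

variable {B : ℝ} {a : ℝ → ℂ}

lemma Ism_all (h : Adm B a) (ν c : ℝ) (hν : 0 < ν) :
    ‖Ism a ν c‖ ≤ 600 * B * (1 / ν * (1 / (1 + c ^ 2)) + 1 / (1 + (ν * c) ^ 2)) := by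
  have hB := h.B_nonneg
  by_cases hc : 4 ≤ |c|
  · have hac : a c = 0 := by
      apply h.zero
      intro hh
      have : |c| ≤ 2 := abs_le.2 ⟨by linarith [hh.1], hh.2⟩
      linarith
    have h1 := h.trivial_le ν c
    have h2 := h.far_le ν c hν hc
    have e : Ism a ν c = ∫ v : ℝ, a v * Complex.exp (2 * π * Complex.I * ν * ((v : ℂ) - c) ^ 2) := by
      unfold Ism; rw [hac, mul_zero, sub_zero]
    rw [e]
    have hc0 : c ≠ 0 := by rintro rfl; norm_num at hc
    have hx : 0 < (ν * c) ^ 2 := by positivity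
    have h3 : ‖∫ v : ℝ, a v * Complex.exp (2 * π * Complex.I * ν * ((v : ℂ) - c) ^ 2)‖ ≤ 600 * B * (1 / (1 + (ν * c) ^ 2)) := by
      rw [mul_one_div, le_div_iff₀ (by positivity)]
      rw [le_div_iff₀ hx] at h2
      nlinarith
    refine h3.trans ?_
    have : 0 ≤ 1 / ν * (1 / (1 + c ^ 2)) := by positivity
    gcongr
    linarith
  · push Not at hc
    have hc2 : c ^ 2 ≤ 16 := by
      rw [← sq_abs]; nlinarith [abs_nonneg c]
    refine (h.Ism_le ν c hν).trans ?_
    have h1 : 1 / 17 ≤ 1 / (1 + c ^ 2) := one_div_le_one_div_of_le (by positivity) (by linarith)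
    have h2 : 0 ≤ 1 / (1 + (ν * c) ^ 2) := by positivity
    have h3 : 0 ≤ B * (1 / ν) := by positivity
    have h4 : 0 ≤ B * (1 / (1 + (ν * c) ^ 2)) := by positivity
    have h5 := mul_le_mul_of_nonneg_left h1 h3
    have : 32 * B / ν = 32 * (B * (1 / ν)) := by ring
    rw [this]
    nlinarith

lemma exc_nonpos (h : Adm B a) (ν c : ℝ) (hν : 0 < ν) (hc : a c = 0) :
    ‖Ism a ν c‖ ≤ 32 * B * (1 / √ν) * gmin (1 / √ν) := by
  have hB := h.B_nonneg
  have hs : 0 < √ν := Real.sqrt_pos.2 hν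
  have e1 : 1 / ν = (1 / √ν) * (1 / √ν) := by
    rw [one_div_mul_one_div, Real.mul_self_sqrt hν.le]
  have h1 := h.Ism_le ν c hν
  have h2 : ‖Ism a ν c‖ ≤ 2 * B := by
    have := h.trivial_le ν c
    unfold Ism; rwa [hc, mul_zero, sub_zero]
  unfold gmin
  rcases min_cases (1 / √ν) (1 / (1 / √ν)) with ⟨hh, _⟩ | ⟨hh, _⟩
  · rw [hh]
    refine h1.trans (le_of_eq ?_)
    rw [mul_assoc, ← e1]; ring
  · rw [hh, mul_assoc, mul_one_div_cancel (by positivity)]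
    linarith

lemma exc_pos (h : Adm B a) (ν c : ℝ) (hν : 0 < ν) (hc : 0 < c) :
    ‖Ism a ν c‖ ≤ 32 * B * (1 / √ν) * (gmin (1 / √ν) + gmin c) := by
  have hB := h.B_nonneg
  have hs : 0 < √ν := Real.sqrt_pos.2 hν
  have hgc := gmin_nonneg hc
  have hr : 0 < 1 / √ν := by positivity
  by_cases hc2 : c ∈ Set.Icc (1/2 : ℝ) 2
  · have e1 : 1 / ν = (1 / √ν) * (1 / √ν) := by
      rw [one_div_mul_one_div, Real.mul_self_sqrt hν.le]
    have h1 := h.Ism_le ν c hν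
    have hg : 1 / 2 ≤ gmin c := by
      unfold gmin
      apply le_min hc2.1
      exact one_div_le_one_div_of_le hc hc2.2
    have h2 : ‖Ism a ν c‖ ≤ 2 * B + 1 / √ν * B := by
      unfold Ism
      refine (norm_sub_le _ _).trans (add_le_add (h.trivial_le ν c) ?_)
      rw [norm_mul, Kfr_norm]
      have hb : ‖a c‖ ≤ B := by simpa using h.bound 0 (by norm_num) c
      refine mul_le_mul ?_ hb (norm_nonneg _) hr.le
      apply one_div_le_one_div_of_le hs
      exact Real.sqrt_le_sqrt (by linarith)
    have hx : 0 ≤ B * (1 / √ν) := by positivity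
    have hy := mul_le_mul_of_nonneg_left hg hx
    have hgr := gmin_nonneg hr
    unfold gmin at hgr ⊢
    unfold gmin at hy hgc
    rcases min_cases (1 / √ν) (1 / (1 / √ν)) with ⟨hh, _⟩ | ⟨hh, _⟩
    · rw [hh]
      refine h1.trans ?_
      rw [mul_add, mul_assoc (32 * B) (1 / √ν) (1 / √ν), ← e1]
      have : 0 ≤ 32 * B * (1 / √ν) * min c (1 / c) := by positivity
      have : 32 * B / ν = 32 * B * (1 / ν) := by ring
      linarith
    · rw [hh, mul_add, mul_assoc _ _ (1 / (1 / √ν)), mul_one_div_cancel hr.ne']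
      nlinarith
  · refine (h.exc_nonpos ν c hν (h.zero hc2)).trans ?_
    gcongr
    linarith

end Adm


lemma iter_bounded (f : ℝ → ℂ) (hf : ContDiff ℝ (⊤ : ℕ∞) f) (hc : HasCompactSupport f) :
    ∃ M, 0 ≤ M ∧ ∀ j ≤ 3, ∀ v, ‖iteratedDeriv j f v‖ ≤ M := by
  have h1 : ∀ j : ℕ, ∃ M, ∀ v, ‖iteratedFDeriv ℝ j f v‖ ≤ M := fun j =>
    (hc.iteratedFDeriv j).exists_bound_of_continuous
      (hf.continuous_iteratedFDeriv (by exact_mod_cast le_top))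
  choose M hM using h1
  have hM0 : ∀ j, 0 ≤ M j := fun j => (norm_nonneg _).trans (hM j 0)
  refine ⟨∑ j ∈ Finset.range 4, M j, Finset.sum_nonneg fun j _ => hM0 j, fun j hj v => ?_⟩
  rw [← norm_iteratedFDeriv_eq_norm_iteratedDeriv]
  exact (hM j v).trans (Finset.single_le_sum (f := M) (fun i _ => hM0 i) (Finset.mem_range.2 (by omega)))

/-- The amplitude `(1+δ v)^{-s} η(v)`. -/
noncomputable def amp (s : ℝ) (η : ℝ → ℝ) (δ v : ℝ) : ℂ :=
  (((1 + δ * v) ^ (-s) : ℝ) : ℂ) * ((η v : ℝ) : ℂ)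

lemma exists_cutoff (s : ℝ) : ∃ w : ℝ → ℂ, ContDiff ℝ (⊤ : ℕ∞) w ∧ HasCompactSupport w ∧
    ∀ t ∈ Set.Icc (1 : ℝ) 3, w t = ((t ^ (-s) : ℝ) : ℂ) := by
  let f : ContDiffBump (2 : ℝ) := ⟨1, 3 / 2, by norm_num, by norm_num⟩
  have hf1 : f.rIn = 1 := rfl
  have hf2 : f.rOut = 3 / 2 := rfl
  refine ⟨fun t => ((f t * t ^ (-s) : ℝ) : ℂ), ?_, ?_, ?_⟩
  · apply Complex.ofRealCLM.contDiff.comp (f := fun t => f t * t ^ (-s))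
    rw [contDiff_iff_contDiffAt]
    intro t
    by_cases ht : t = 0
    · subst ht
      have : (fun t => f t * t ^ (-s)) =ᶠ[nhds 0] fun _ => (0 : ℝ) := by
        filter_upwards [Metric.ball_mem_nhds (0 : ℝ) (by norm_num : (0 : ℝ) < 1 / 2)] with x hx
        rw [f.zero_of_le_dist, zero_mul]
        rw [Metric.mem_ball, Real.dist_eq, sub_zero, abs_lt] at hx
        rw [hf2, Real.dist_eq, abs_sub_comm, abs_of_nonneg] <;> linarith [hx.2]
      exact contDiffAt_const.congr_of_eventuallyEq this
    · exact f.contDiffAt.mul (Real.contDiffAt_rpow_const_of_ne ht)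
  · refine HasCompactSupport.intro (isCompact_closedBall (2 : ℝ) (3 / 2)) ?_
    intro x hx
    have : f x = 0 := f.zero_of_le_dist (by
      rw [Metric.mem_closedBall, not_le] at hx
      rw [hf2]; exact hx.le)
    simp [this]
  · intro t ht
    have : f t = 1 := f.one_of_mem_closedBall (by
      rw [hf1, Metric.mem_closedBall, Real.dist_eq, abs_le]
      constructor <;> linarith [ht.1, ht.2])
    simp [this]

lemma amp_adm (s : ℝ) (η : ℝ → ℝ) (hη : ContDiff ℝ (⊤ : ℕ∞) η)
    (hsupp : tsupport η ⊆ Set.Icc (1/2 : ℝ) 2) :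
    ∃ B : ℝ, ∀ δ : ℝ, 0 ≤ δ → δ ≤ 1 → Adm B (amp s η δ) := by
  obtain ⟨w, hw, hwc, hweq⟩ := exists_cutoff s
  obtain ⟨M, hM0, hM⟩ := iter_bounded w hw hwc
  set e : ℝ → ℂ := fun v => ((η v : ℝ) : ℂ) with he
  have hes : ContDiff ℝ (⊤ : ℕ∞) e := Complex.ofRealCLM.contDiff.comp hη
  have hz : ∀ v, v ∉ Set.Icc (1/2 : ℝ) 2 → η v = 0 := fun v hv =>
    image_eq_zero_of_notMem_tsupport fun hh => hv (hsupp hh)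
  have hec : HasCompactSupport e := HasCompactSupport.intro (isCompact_Icc (a := (1/2 : ℝ)) (b := 2)) (by
    intro x hx; simp [he, hz x hx])
  obtain ⟨L, hL0, hL⟩ := iter_bounded e hes hec
  refine ⟨8 * (M * L), fun δ h0 h1 => ?_⟩
  have heq : amp s η δ = fun v => w (1 + δ * v) * e v := by
    funext v
    by_cases hv : v ∈ Set.Icc (1/2 : ℝ) 2
    · unfold amp
      rw [hweq]
      constructor
      · nlinarith [hv.1]
      · nlinarith [hv.1, hv.2]
    · simp [amp, he, hz v hv]
  have hws : ContDiff ℝ (⊤ : ℕ∞) (fun v => w (1 + δ * v)) := hw.comp (by fun_prop)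
  refine ⟨?_, ?_, ?_⟩
  · rw [heq]; exact hws.mul hes
  · refine closure_minimal ?_ isClosed_Icc
    intro x hx
    by_contra hxs
    apply hx
    simp [amp, hz x hxs]
  · intro j hj v
    have hb : ∀ i ≤ 3, ‖iteratedDeriv i (fun v => w (1 + δ * v)) v‖ ≤ M := by
      intro i hi
      have hwi : ContDiff ℝ (i : ℕ∞) w := hw.of_le (by exact_mod_cast le_top)
      have := iteratedDeriv_comp_const_smul (n := i) (f := fun z => w (1 + z)) (hwi.comp (by fun_prop)) δ
      rw [this, iteratedDeriv_comp_const_add]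
      simp only [norm_smul, norm_pow, Real.norm_of_nonneg h0]
      calc δ ^ i * _ ≤ 1 * M := mul_le_mul (pow_le_one₀ h0 h1) (hM i hi _) (norm_nonneg _) zero_le_one
        _ = M := one_mul _
    rw [heq, iteratedDeriv_fun_mul (hws.of_le (by exact_mod_cast le_top)).contDiffAt
      (hes.of_le (by exact_mod_cast le_top)).contDiffAt]
    refine (norm_sum_le _ _).trans ?_
    have : ∀ i ∈ Finset.range (j + 1), ‖((j.choose i : ℕ) : ℂ) * iteratedDeriv i (fun v => w (1 + δ * v)) v * iteratedDeriv (j - i) e v‖ ≤ (j.choose i : ℝ) * (M * L) := by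
      intro i hi
      rw [Finset.mem_range] at hi
      rw [norm_mul, norm_mul, Complex.norm_natCast, mul_assoc]
      gcongr
      · exact hb i (by omega)
      · exact hL _ (by omega) v
    refine (Finset.sum_le_sum this).trans ?_
    rw [← Finset.sum_mul, ← Nat.cast_sum, Nat.sum_range_choose]
    gcongr
    have : 2 ^ j ≤ 2 ^ 3 := Nat.pow_le_pow_right (by norm_num) hj
    calc ((2 ^ j : ℕ) : ℝ) ≤ ((2 ^ 3 : ℕ) : ℝ) := by exact_mod_cast this
      _ = 8 := by norm_num


lemma schwartz_summable (f : SchwartzMap ℝ ℂ) : Summable fun n : ℤ => f (n : ℝ) :=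
  summable_of_isBigO (Real.summable_abs_int_rpow one_lt_two)
    ((f.isBigO_cocompact_rpow (-2)).comp_tendsto Int.tendsto_coe_cofinite)

lemma norm_cexp_I (x : ℂ) (t : ℝ) (h : x = t * Complex.I) : ‖Complex.exp x‖ = 1 := by
  rw [h, Complex.norm_exp_ofReal_mul_I]

lemma exists_divMod (q : ℕ) [NeZero q] : ∃ E : ℤ × Fin q ≃ ℤ, ∀ x, E x = x.1 * q + (x.2 : ℕ) :=
  ⟨(Int.divModEquiv q).symm, fun _ => rfl⟩

open FourierTransform in
lemma twisted_poisson (p : ℤ) (q : ℕ) (hq : 1 ≤ q) (g : ℝ → ℂ) (hg : ContDiff ℝ (⊤ : ℕ∞) g)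
    (hgc : HasCompactSupport g) :
    HasSum (fun m : ℤ => (1 / (q : ℂ)) * gaussTau p q m *
        ∫ y : ℝ, g y * Complex.exp (-(2 * π * Complex.I * m * y / q)))
      (∑' n : ℤ, Complex.exp (2 * π * Complex.I * (p * (n : ℂ) ^ 2) / q) * g n) := by
  have : NeZero q := ⟨by omega⟩
  have hq0 : (q : ℝ) ≠ 0 := by exact_mod_cast (by omega : q ≠ 0)
  have hqc : (q : ℂ) ≠ 0 := by exact_mod_cast (by omega : q ≠ 0)
  have hqpos : (0 : ℝ) < q := by exact_mod_cast hq
  set gq : ℝ → ℂ := fun x => g (q * x) with hgq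
  have hgqs : ContDiff ℝ (⊤ : ℕ∞) gq := hg.comp (by fun_prop)
  have hgqc : HasCompactSupport gq :=
    hgc.comp_homeomorph (Homeomorph.mulLeft₀ (q : ℝ) hq0)
  obtain ⟨S, hSv⟩ : ∃ S : SchwartzMap ℝ ℂ, ∀ x, S x = g (q * x) := ⟨hgqc.toSchwartzMap hgqs, fun x => rfl⟩
  -- the Fourier transform
  have hF : ∀ m : ℤ, 𝓕 S (m : ℝ) = (1 / (q : ℂ)) * ∫ y : ℝ, g y * Complex.exp (-(2 * π * Complex.I * m * y / q)) := by
    intro m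
    rw [SchwartzMap.fourier_coe, Real.fourier_eq']
    have h1 := Measure.integral_comp_mul_left (fun y : ℝ => g y * Complex.exp (-(2 * π * Complex.I * m * y / q))) (q : ℝ)
    have h2 : |(q : ℝ)⁻¹| = (q : ℝ)⁻¹ := abs_of_nonneg (by positivity)
    rw [h2, Complex.real_smul] at h1
    rw [one_div]
    push_cast at h1
    rw [← h1]
    refine integral_congr_ae (Eventually.of_forall fun x => ?_)
    simp only [hSv, smul_eq_mul, RCLike.inner_apply, conj_trivial]
    rw [mul_comm]
    congr 2
    push_cast
    field_simp
  have hFs : Summable fun m : ℤ => 𝓕 S (m : ℝ) := schwartz_summable (𝓕 S)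
  -- Poisson for each residue
  have hP : ∀ b : ℕ, HasSum (fun m : ℤ => 𝓕 S (m : ℝ) * Complex.exp (2 * π * Complex.I * (m * b) / q))
      (∑' j : ℤ, g (b + q * j)) := by
    intro b
    have h1 := S.tsum_eq_tsum_fourier ((b : ℝ) / q)
    have e1 : ∀ j : ℤ, S ((b : ℝ) / q + j) = g (b + q * j) := by
      intro j; rw [hSv]; congr 1; field_simp
    have e2 : ∀ m : ℤ, 𝓕 S (m : ℝ) * fourier m (((b : ℝ) / q : ℝ) : UnitAddCircle) =
        𝓕 S (m : ℝ) * Complex.exp (2 * π * Complex.I * (m * b) / q) := by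
      intro m
      rw [fourier_coe_apply]
      congr 2
      push_cast
      field_simp
    simp only [e1, e2] at h1
    rw [h1]
    apply Summable.hasSum
    refine Summable.of_norm_bounded (g := fun m : ℤ => ‖𝓕 S (m : ℝ)‖) hFs.norm fun m => ?_
    rw [norm_mul, norm_cexp_I _ (2 * π * (m * b) / q) (by push_cast; ring), mul_one]
  -- split the left side into residues
  have hL : ∑' n : ℤ, Complex.exp (2 * π * Complex.I * (p * (n : ℂ) ^ 2) / q) * g n =
      ∑ b ∈ Finset.range q, Complex.exp (2 * π * Complex.I * (p * (b : ℂ) ^ 2) / q) * ∑' j : ℤ, g (b + q * j) := by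
    set u : ℤ → ℂ := fun n => Complex.exp (2 * π * Complex.I * (p * (n : ℂ) ^ 2) / q) * g n with hu
    have hus : Summable u := by
      refine Summable.of_norm_bounded (g := fun n : ℤ => ‖g (n : ℝ)‖)
        (schwartz_summable (hgc.toSchwartzMap hg)).norm fun n => ?_
      rw [hu]
      simp only
      rw [norm_mul, norm_cexp_I _ (2 * π * (p * n ^ 2) / q) (by push_cast; ring), one_mul]
    obtain ⟨E, hE⟩ := exists_divMod q
    have hus2 : Summable fun x : ℤ × Fin q => u (E x) := E.summable_iff.2 hus
    have hus3 : Summable fun x : Fin q × ℤ => u (E x.swap) := (Equiv.prodComm (Fin q) ℤ).summable_iff.2 hus2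
    calc ∑' n : ℤ, u n = ∑' x : ℤ × Fin q, u (E x) := (E.tsum_eq u).symm
      _ = ∑' x : Fin q × ℤ, u (E x.swap) := ((Equiv.prodComm (Fin q) ℤ).tsum_eq (fun x => u (E x))).symm
      _ = ∑' b : Fin q, ∑' j : ℤ, u (E (j, b)) := hus3.tsum_prod
      _ = ∑ b : Fin q, ∑' j : ℤ, u (E (j, b)) := tsum_fintype _
      _ = _ := by
        rw [Finset.sum_range]
        refine Finset.sum_congr rfl fun b _ => ?_
        rw [← tsum_mul_left]
        refine tsum_congr fun j => ?_
        rw [hE]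
        simp only [hu]
        congr 1
        · rw [Complex.exp_eq_exp_iff_exists_int]
          refine ⟨p * (q * j ^ 2 + 2 * j * b), ?_⟩
          push_cast
          field_simp
          ring
        · push_cast
          congr 1
          ring
  rw [hL]
  have := hasSum_sum (s := Finset.range q) fun b _ => (hP b).mul_left (Complex.exp (2 * π * Complex.I * (p * (b : ℂ) ^ 2) / q))
  have hm : ∀ m : ℤ, (1 / (q : ℂ)) * gaussTau p q m *
        ∫ y : ℝ, g y * Complex.exp (-(2 * π * Complex.I * m * y / q)) =
      ∑ b ∈ Finset.range q, Complex.exp (2 * π * Complex.I * (p * (b : ℂ) ^ 2) / q) *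
        (𝓕 S (m : ℝ) * Complex.exp (2 * π * Complex.I * (m * b) / q)) := by
    intro m
    rw [mul_right_comm, ← hF]
    unfold gaussTau
    rw [Finset.mul_sum]
    refine Finset.sum_congr rfl fun b _ => ?_
    rw [mul_left_comm, ← Complex.exp_add]
    congr 2
    ring
  simp only [hm]
  exact this


section ident

variable (s : ℝ) (η : ℝ → ℝ) (N q : ℕ) (h K : ℝ)

/-- The function to which Poisson summation is applied. -/
noncomputable def fP (x : ℝ) : ℂ :=
  (((N : ℝ) ^ (-s) : ℝ) : ℂ) * amp s η K⁻¹ (K * (x / N - 1)) *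
    Complex.exp (2 * π * Complex.I * h * (x : ℂ) ^ 2)

/-- Stationary points in the rescaled variable. -/
noncomputable def cM (m : ℤ) : ℝ := K * ((m : ℝ) / (2 * N * h * q) - 1)

lemma amp_rescale (hK : 0 < K) (t : ℝ) :
    amp s η K⁻¹ (K * (t - 1)) = ((t ^ (-s) : ℝ) : ℂ) * ((η (K * (t - 1)) : ℝ) : ℂ) := by
  unfold amp
  have : 1 + K⁻¹ * (K * (t - 1)) = t := by field_simp; ring
  rw [this]

variable {s η N q h K}

lemma fP_smooth {B : ℝ} (ha : Adm B (amp s η K⁻¹)) : ContDiff ℝ (⊤ : ℕ∞) (fP s η N h K) := by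
  unfold fP
  refine (contDiff_const.mul (ha.smooth.comp (by fun_prop))).mul ?_
  refine ContDiff.cexp ?_
  exact contDiff_const.mul (Complex.ofRealCLM.contDiff.pow 2)

lemma fP_zero {B : ℝ} (ha : Adm B (amp s η K⁻¹)) (hK : 0 < K) (hN : 0 < (N : ℝ)) {x : ℝ} (hx : x ≤ 0) :
    fP s η N h K x = 0 := by
  unfold fP
  rw [ha.zero]
  · simp
  · intro hh
    have h1 := hh.1
    have : x / N ≤ 0 := div_nonpos_of_nonpos_of_nonneg hx hN.le
    nlinarith

lemma fP_compact {B : ℝ} (ha : Adm B (amp s η K⁻¹)) (hK : 0 < K) (hN : 0 < (N : ℝ)) :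
    HasCompactSupport (fP s η N h K) := by
  refine HasCompactSupport.intro (isCompact_Icc (a := (0 : ℝ)) (b := N * (1 + 2 / K))) ?_
  intro x hx
  unfold fP
  rw [ha.zero]
  · simp
  · intro hh
    apply hx
    have h1 := hh.1
    have h2 := hh.2
    rw [← le_div_iff₀' hK] at h2
    constructor
    · by_contra h0
      push Not at h0
      have : x / N ≤ 0 := div_nonpos_of_nonpos_of_nonneg h0.le hN.le
      nlinarith
    · rw [← div_le_iff₀' hN]; linarith

lemma F_ident {B : ℝ} (ha : Adm B (amp s η K⁻¹)) (hK : 0 < K) (hN : 0 < (N : ℝ)) (p : ℤ) :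
    FphiN s (fun t => ((η (K * (t - 1)) : ℝ) : ℂ)) N ((p : ℝ) / q + h) =
      ∑' n : ℤ, Complex.exp (2 * π * Complex.I * (p * (n : ℂ) ^ 2) / q) * fP s η N h K n := by
  have hinj : Function.Injective (fun n : ℕ => (n : ℤ) + 1) := fun a b hab => by
    simpa using hab
  rw [← hinj.tsum_eq (f := fun n : ℤ => Complex.exp (2 * π * Complex.I * (p * (n : ℂ) ^ 2) / q) * fP s η N h K n)]
  · unfold FphiN
    refine tsum_congr fun n => ?_
    unfold fP
    rw [amp_rescale s η K hK]
    have hn : (0 : ℝ) < (n : ℝ) + 1 := by positivity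
    push_cast
    have e1 : ((n : ℝ) + 1) ^ (-s) = (N : ℝ) ^ (-s) * (((n : ℝ) + 1) / N) ^ (-s) := by
      rw [← Real.mul_rpow hN.le (by positivity)]
      congr 1; field_simp
    have e2 : Complex.exp (2 * π * Complex.I * ((n : ℂ) + 1) ^ 2 * ((p : ℂ) / q + h)) =
        Complex.exp (2 * π * Complex.I * (p * ((n : ℂ) + 1) ^ 2) / q) *
          Complex.exp (2 * π * Complex.I * h * ((n : ℂ) + 1) ^ 2) := by
      rw [← Complex.exp_add]; congr 1; ring
    rw [e1, e2]
    push_cast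
    ring
  · intro n hn
    by_contra hr
    apply hn
    have : n ≤ 0 := by
      by_contra h0
      push Not at h0
      exact hr ⟨(n - 1).toNat, by simp; omega⟩
    simp only
    rw [fP_zero ha hK hN (by exact_mod_cast this), mul_zero]

lemma int_ident (hK : 0 < K) (hN : 0 < (N : ℝ)) (hq : 0 < (q : ℝ)) (hh : 0 < h) (m : ℤ) :
    ∫ y : ℝ, fP s η N h K y * Complex.exp (-(2 * π * Complex.I * m * y / q)) =
      (((N : ℝ) ^ (1 - s) * K⁻¹ : ℝ) : ℂ) * Complex.exp (-(Complex.I * π * (m : ℂ) ^ 2 / (2 * (q : ℂ) ^ 2 * h))) *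
        ∫ v : ℝ, amp s η K⁻¹ v * Complex.exp (2 * π * Complex.I * ((N ^ 2 * h * K⁻¹ ^ 2 : ℝ) : ℂ) *
          ((v : ℂ) - (cM N q h K m : ℝ)) ^ 2) := by
  set Φ : ℝ → ℂ := fun y => fP s η N h K y * Complex.exp (-(2 * π * Complex.I * m * y / q)) with hΦ
  have h1 := Measure.integral_comp_mul_left (fun y => Φ (N + y)) (N * K⁻¹)
  rw [integral_add_left_eq_self Φ, abs_of_pos (by positivity)] at h1
  have h2 : ∫ y, Φ y = ((N * K⁻¹ : ℝ) : ℂ) * ∫ v : ℝ, Φ (N + N * K⁻¹ * v) := by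
    rw [h1, Complex.real_smul, ← mul_assoc, ← Complex.ofReal_mul, mul_inv_cancel₀ (by positivity)]
    simp
  rw [h2, ← integral_const_mul, ← integral_const_mul]
  refine integral_congr_ae (Eventually.of_forall fun v => ?_)
  simp only [hΦ]
  unfold fP
  have e1 : K * ((N + N * K⁻¹ * v) / N - 1) = v := by field_simp; ring
  have e2 : (N : ℝ) ^ (1 - s) = N * (N : ℝ) ^ (-s) := by
    rw [sub_eq_add_neg, Real.rpow_add hN, Real.rpow_one]
  have hNc : (N : ℂ) ≠ 0 := by exact_mod_cast hN.ne'
  have hqc : (q : ℂ) ≠ 0 := by exact_mod_cast hq.ne'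
  have hhc : (h : ℂ) ≠ 0 := by exact_mod_cast hh.ne'
  have hKc : (K : ℂ) ≠ 0 := by exact_mod_cast hK.ne'
  have e3 : Complex.exp (2 * π * Complex.I * h * ((N + N * K⁻¹ * v : ℝ) : ℂ) ^ 2) *
      Complex.exp (-(2 * π * Complex.I * m * ((N + N * K⁻¹ * v : ℝ) : ℂ) / q)) =
      Complex.exp (-(Complex.I * π * (m : ℂ) ^ 2 / (2 * (q : ℂ) ^ 2 * h))) *
      Complex.exp (2 * π * Complex.I * ((N ^ 2 * h * K⁻¹ ^ 2 : ℝ) : ℂ) *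
          ((v : ℂ) - (cM N q h K m : ℝ)) ^ 2) := by
    rw [← Complex.exp_add, ← Complex.exp_add]
    congr 1
    unfold cM
    push_cast
    field_simp
    ring
  rw [e1, e2]
  push_cast at e3 ⊢
  linear_combination ((N : ℂ) * (K : ℂ)⁻¹ * ((((N : ℝ) ^ (-s) : ℝ)) : ℂ) * amp s η K⁻¹ v) * e3

lemma main_ident (hK : 0 < K) (hN : 0 < (N : ℝ)) (hq : 0 < (q : ℝ)) (p : ℤ) :
    gaussTheta p q 0 * ((((N : ℝ) ^ (1 - s) : ℝ)) : ℂ) / (Real.sqrt q : ℂ) *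
      (∫ t : ℝ, Complex.exp (2 * Real.pi * Complex.I * (N : ℂ) ^ 2 * (h : ℂ) * (t : ℂ) ^ 2) *
        (((t ^ (-s) : ℝ)) : ℂ) * ((η (K * (t - 1)) : ℝ) : ℂ)) =
    (1 / (q : ℂ)) * gaussTau p q 0 *
        ∫ y : ℝ, fP s η N h K y * Complex.exp (-(2 * π * Complex.I * (0 : ℤ) * y / q)) := by
  have h1 := Measure.integral_comp_mul_left (fP s η N h K) N
  rw [abs_of_pos (by positivity)] at h1
  have h2 : ∫ y, fP s η N h K y = (N : ℂ) * ∫ v : ℝ, fP s η N h K (N * v) := by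
    have : (N : ℂ) = ((N : ℝ) : ℂ) := by simp
    rw [h1, Complex.real_smul, ← mul_assoc, this, ← Complex.ofReal_mul, mul_inv_cancel₀ (by positivity)]
    simp
  have h3 : ∫ y : ℝ, fP s η N h K y * Complex.exp (-(2 * π * Complex.I * (0 : ℤ) * y / q)) =
      ∫ y, fP s η N h K y := by simp
  have hsq : ((Real.sqrt q : ℝ) : ℂ) * ((Real.sqrt q : ℝ) : ℂ) = q := by
    rw [← Complex.ofReal_mul, Real.mul_self_sqrt hq.le]; simp
  have hsq0 : ((Real.sqrt q : ℝ) : ℂ) ≠ 0 := by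
    exact_mod_cast (Real.sqrt_pos.2 hq).ne'
  have e2 : (N : ℝ) ^ (1 - s) = N * (N : ℝ) ^ (-s) := by
    rw [sub_eq_add_neg, Real.rpow_add hN, Real.rpow_one]
  rw [h3, h2]
  have h4 : ∀ v : ℝ, fP s η N h K (N * v) = (((N : ℝ) ^ (-s) : ℝ) : ℂ) *
      (Complex.exp (2 * Real.pi * Complex.I * (N : ℂ) ^ 2 * (h : ℂ) * (v : ℂ) ^ 2) *
        (((v ^ (-s) : ℝ)) : ℂ) * ((η (K * (v - 1)) : ℝ) : ℂ)) := by
    intro v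
    unfold fP
    rw [mul_div_cancel_left₀ _ hN.ne', amp_rescale s η K hK]
    have : 2 * π * Complex.I * h * ((N * v : ℝ) : ℂ) ^ 2 = 2 * Real.pi * Complex.I * (N : ℂ) ^ 2 * (h : ℂ) * (v : ℂ) ^ 2 := by
      push_cast; ring
    rw [this]; ring
  simp only [h4]
  rw [integral_const_mul, e2]
  unfold gaussTheta
  rw [← hsq]
  push_cast
  field_simp

lemma amp_cM_zero {B : ℝ} (ha : Adm B (amp s η K⁻¹)) (hK : 0 < K) (hN : 0 < (N : ℝ)) (hq : 0 < (q : ℝ))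
    (hh : 0 < h) {m : ℤ} (hm : m ≤ 0) : amp s η K⁻¹ (cM N q h K m) = 0 := by
  apply ha.zero
  intro h1
  have h2 := h1.1
  unfold cM at h2
  have : (m : ℝ) / (2 * N * h * q) ≤ 0 :=
    div_nonpos_of_nonpos_of_nonneg (by exact_mod_cast hm) (by positivity)
  nlinarith

lemma G_ident {B : ℝ} (ha : Adm B (amp s η K⁻¹)) (hK : 0 < K) (hN : 0 < (N : ℝ)) (hq : 0 < (q : ℝ))
    (hh : 0 < h) (p : ℤ) :
    HasSum (fun m : ℤ => (1 / (q : ℂ)) * gaussTau p q m * ((((N : ℝ) ^ (1 - s) * K⁻¹ : ℝ) : ℂ) *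
      Complex.exp (-(Complex.I * π * (m : ℂ) ^ 2 / (2 * (q : ℂ) ^ 2 * h))) *
        (Kfr (N ^ 2 * h * K⁻¹ ^ 2) * amp s η K⁻¹ (cM N q h K m))))
      (GphiN s (fun t => ((η (K * (t - 1)) : ℝ) : ℂ)) p q N h) := by
  set u : ℤ → ℂ := fun m : ℤ => (1 / (q : ℂ)) * gaussTau p q m * ((((N : ℝ) ^ (1 - s) * K⁻¹ : ℝ) : ℂ) *
      Complex.exp (-(Complex.I * π * (m : ℂ) ^ 2 / (2 * (q : ℂ) ^ 2 * h))) *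
        (Kfr (N ^ 2 * h * K⁻¹ ^ 2) * amp s η K⁻¹ (cM N q h K m))) with hu
  have hA : 0 < 2 * N * h * q := by positivity
  have hz : ∀ m : ℤ, m ≤ 0 → u m = 0 := by
    intro m hm
    simp only [hu]
    rw [amp_cM_zero ha hK hN hq hh hm]; simp
  have hsum : Summable u := by
    apply summable_of_ne_finset_zero (s := Finset.Icc 0 ⌈2 * N * h * q * (1 + 2 / K)⌉)
    intro m hm
    by_cases hm0 : m ≤ 0
    · exact hz m hm0
    · have hm1 : ⌈2 * N * h * q * (1 + 2 / K)⌉ < m := by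
        by_contra h3
        exact hm (Finset.mem_Icc.2 ⟨by omega, by omega⟩)
      have hm2 : 2 * N * h * q * (1 + 2 / K) < (m : ℝ) := (Int.le_ceil _).trans_lt (by exact_mod_cast hm1)
      simp only [hu]
      rw [ha.zero]
      · simp
      · intro h1
        have h2 := h1.2
        unfold cM at h2
        rw [← le_div_iff₀' hK] at h2
        rw [← lt_div_iff₀' hA] at hm2
        linarith
  have hG : GphiN s (fun t => ((η (K * (t - 1)) : ℝ) : ℂ)) p q N h = ∑' m : ℤ, u m := by
    have hinj : Function.Injective (fun n : ℕ => (n : ℤ) + 1) := fun a b hab => by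
      simpa using hab
    rw [← hinj.tsum_eq (f := u)]
    · unfold GphiN
      rw [← tsum_mul_left]
      refine tsum_congr fun n => ?_
      simp only [hu]
      unfold cM
      rw [amp_rescale s η K hK]
      unfold Kfr gaussTheta
      push_cast
      have hn : (0 : ℝ) < (n : ℝ) + 1 := by positivity
      have key : (2 * h * q) ^ (s - 1/2) * (1 / √q) * ((n : ℝ) + 1) ^ (-s) =
          1 / q * ((N : ℝ) ^ (1 - s) * K⁻¹) * (1 / √(2 * (N ^ 2 * h * K⁻¹ ^ 2))) *
            (((n : ℝ) + 1) / (2 * N * h * q)) ^ (-s) := by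
        have k1 : √(2 * (N ^ 2 * h * K⁻¹ ^ 2)) = N * K⁻¹ * √(2 * h) := by
          rw [show 2 * (N ^ 2 * h * K⁻¹ ^ 2) = (N * K⁻¹) ^ 2 * (2 * h) by ring,
            Real.sqrt_mul (by positivity), Real.sqrt_sq (by positivity)]
        have k2 : (2 * h * q) ^ (s - 1/2) = (2 * h * q) ^ s / (√(2 * h) * √q) := by
          rw [Real.rpow_sub (by positivity), ← Real.sqrt_eq_rpow, Real.sqrt_mul (by positivity)]
        have k3 : (((n : ℝ) + 1) / (2 * N * h * q)) ^ (-s) =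
            ((n : ℝ) + 1) ^ (-s) * ((N : ℝ) ^ s * (2 * h * q) ^ s) := by
          rw [Real.div_rpow hn.le hA.le, Real.rpow_neg hA.le, div_inv_eq_mul,
            show 2 * N * h * q = N * (2 * h * q) by ring, Real.mul_rpow hN.le (by positivity)]
        have k4 : (N : ℝ) ^ (1 - s) = N / (N : ℝ) ^ s := by
          rw [Real.rpow_sub hN, Real.rpow_one]
        have k5 : (q : ℝ) = √q * √q := (Real.mul_self_sqrt hq.le).symm
        rw [k1, k2, k3, k4]
        have hNs : 0 < (N : ℝ) ^ s := by positivity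
        have hsq : 0 < √(q : ℝ) := Real.sqrt_pos.2 hq
        generalize (2 * h * (q : ℝ)) ^ s = X
        generalize ((n : ℝ) + 1) ^ (-s) = Y
        generalize (N : ℝ) ^ s = Z at *
        have : 0 < √(2 * h) := by positivity
        field_simp
        rw [Real.sq_sqrt hq.le]
        ring
      have key2 := congrArg (fun x : ℝ => (x : ℂ)) key
      push_cast at key2
      linear_combination (gaussTau p q (n + 1) * Complex.exp (Complex.I * π / 4) *
        Complex.exp (-(Complex.I * π * ((n : ℂ) + 1) ^ 2 / (2 * (q : ℂ) ^ 2 * h))) *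
        ((η (K * (((n : ℝ) + 1) / (2 * N * h * q) - 1)) : ℝ) : ℂ)) * key2
    · intro n hn
      by_contra hr
      apply hn
      apply hz
      by_contra h0
      push Not at h0
      exact hr ⟨(n - 1).toNat, by simp; omega⟩
  rw [hG]
  exact hsum.hasSum

end ident


lemma zprof_nonneg (y : ℝ) (m : ℤ) : 0 ≤ zprof y m := by
  unfold zprof; split_ifs <;> positivity

lemma zprof_bound {B : ℝ} {a : ℝ → ℂ} (ha : Adm B a) (ν σ c : ℝ) (hν : 0 < ν) (j : ℤ) (hj : j ≠ 0)
    (hc : |σ / 2 * j| ≤ |c|) :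
    ‖Ism a ν c‖ ≤ 600 * B * (1 / ν * zprof (σ / 2) j + zprof (ν * σ / 2) j) := by
  have hB := ha.B_nonneg
  refine (ha.Ism_all ν c hν).trans ?_
  unfold zprof
  rw [if_neg hj, if_neg hj]
  have h1 : (σ / 2 * j) ^ 2 ≤ c ^ 2 := sq_le_sq.2 hc
  have h2 : (ν * σ / 2 * j) ^ 2 ≤ (ν * c) ^ 2 := by
    rw [show ν * σ / 2 * j = ν * (σ / 2 * j) by ring, mul_pow ν c, mul_pow ν (σ / 2 * j)]
    exact mul_le_mul_of_nonneg_left h1 (by positivity)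
  have h3 : 1 / (1 + c ^ 2) ≤ 1 / (1 + (σ / 2 * j) ^ 2) :=
    one_div_le_one_div_of_le (by positivity) (by linarith)
  have h4 : 1 / (1 + (ν * c) ^ 2) ≤ 1 / (1 + (ν * σ / 2 * j) ^ 2) :=
    one_div_le_one_div_of_le (by positivity) (by linarith)
  have h5 : 0 ≤ 1 / ν := by positivity
  exact mul_le_mul_of_nonneg_left (add_le_add (mul_le_mul_of_nonneg_left h3 h5) h4) (by positivity)

lemma zprof_shift (y : ℝ) (n0 : ℤ) (hs : Summable (zprof y)) :
    HasSum (fun m : ℤ => zprof y (m - n0)) (∑' m, zprof y m) := by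
  have := (Equiv.hasSum_iff (Equiv.subRight n0)).2 hs.hasSum
  simpa only [Function.comp_def, Equiv.subRight_apply] using this

/-- Sum of all stationary phase errors. -/
lemma ism_sum {B : ℝ} {a : ℝ → ℂ} (ha : Adm B a) (ν A K : ℝ) (hν : 0 < ν) (hA : 0 < A) (hK : 0 < K)
    (c : ℤ → ℝ) (hc : ∀ m : ℤ, c m = K * ((m : ℝ) / (2 * A) - 1)) (hneg : ∀ m, c m ≤ 0 → a (c m) = 0)
    (T : ℝ) (hT0 : 0 ≤ T) (n0 : ℤ) (hn1 : (n0 : ℝ) ≤ 2 * A) (hn2 : 2 * A < (n0 : ℝ) + 1)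
    (hT : 1 / 8 ≤ A → 32 * B * (1 / √ν) * (gmin (1 / √ν) + gmin (c (n0 + 1))) ≤ T)
    (f : ℤ → ℂ) (S : ℂ) (hf : HasSum f S) (M : ℝ) (hM : 0 ≤ M) (hf0 : f 0 = 0)
    (hfm : ∀ m : ℤ, m ≠ 0 → ‖f m‖ ≤ M * ‖Ism a ν (c m)‖) :
    ‖S‖ ≤ M * (19200 * B * A / (ν * K) + 2 * T) := by
  have hB := ha.B_nonneg
  set σ := K / (2 * A) with hσ
  have hσp : 0 < σ := by positivity
  have hc' : ∀ m : ℤ, c m = σ * ((m : ℝ) - 2 * A) := by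
    intro m; rw [hc, hσ]; field_simp
  have hfar : ∀ m : ℤ, 1 / 2 * |((m - n0 : ℤ) : ℝ)| ≤ |(m : ℝ) - 2 * A| → |σ / 2 * ((m - n0 : ℤ) : ℝ)| ≤ |c m| := by
    intro m hm
    rw [hc', abs_mul, abs_mul, abs_of_pos hσp, abs_of_pos (by positivity : 0 < σ / 2)]
    nlinarith
  -- pointwise bound
  set D : ℤ → ℝ := fun m => M * (600 * B * (1 / ν * zprof (σ / 2) (m - n0) + zprof (ν * σ / 2) (m - n0)) +
    ((if m = n0 then T else 0) + (if m = n0 + 1 then T else 0))) with hD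
  have hite : ∀ m x : ℤ, 0 ≤ (if m = x then T else 0) := by
    intro m x; split_ifs <;> simp [hT0]
  have hz0 : ∀ m : ℤ, 0 ≤ 600 * B * (1 / ν * zprof (σ / 2) (m - n0) + zprof (ν * σ / 2) (m - n0)) := by
    intro m
    have := zprof_nonneg (σ / 2) (m - n0)
    have := zprof_nonneg (ν * σ / 2) (m - n0)
    positivity
  have hgood : ∀ m : ℤ, m ≠ n0 → 1 / 2 * |((m - n0 : ℤ) : ℝ)| ≤ |(m : ℝ) - 2 * A| → 
      ‖Ism a ν (c m)‖ ≤ 600 * B * (1 / ν * zprof (σ / 2) (m - n0) + zprof (ν * σ / 2) (m - n0)) +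
    ((if m = n0 then T else 0) + (if m = n0 + 1 then T else 0)) := by
    intro m hm h1
    have := zprof_bound ha ν σ (c m) hν (m - n0) (sub_ne_zero.2 hm) (hfar m h1)
    linarith [hite m n0, hite m (n0 + 1)]
  have hpt : ∀ m : ℤ, m ≠ 0 → ‖Ism a ν (c m)‖ ≤ 600 * B * (1 / ν * zprof (σ / 2) (m - n0) + zprof (ν * σ / 2) (m - n0)) +
    ((if m = n0 then T else 0) + (if m = n0 + 1 then T else 0)) := by
    intro m hm
    by_cases hA8 : 1 / 8 ≤ A
    · have hT' := hT hA8
      have hrp : 0 < 1 / √ν := by positivity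
      have hcp : 0 < c (n0 + 1) := by
        rw [hc']; push_cast; exact mul_pos hσp (by linarith)
      by_cases h1 : m = n0
      · rw [if_pos h1]
        have hcn : c m ≤ 0 := by
          rw [hc', h1]; exact mul_nonpos_of_nonneg_of_nonpos hσp.le (by linarith)
        have h2 := ha.exc_nonpos ν (c m) hν (hneg m hcn)
        have h3 : 0 ≤ 32 * B * (1 / √ν) * gmin (c (n0 + 1)) := by
          have := gmin_nonneg hcp; positivity
        rw [mul_add] at hT'
        linarith [hz0 m, hite m (n0 + 1)]
      · by_cases h2 : m = n0 + 1
        · rw [if_pos h2]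
          have h3 := ha.exc_pos ν (c (n0 + 1)) hν hcp
          rw [← h2] at h3 hT'
          linarith [hz0 m, hite m n0]
        · apply hgood m h1
          rcases lt_or_gt_of_ne h1 with h3 | h3
          · have h4 : (m : ℝ) ≤ n0 - 1 := by exact_mod_cast (by omega : m ≤ n0 - 1)
            push_cast
            rw [abs_of_nonpos (by linarith), abs_of_nonpos (by linarith)]
            linarith
          · have h4 : (n0 : ℝ) + 2 ≤ m := by exact_mod_cast (by omega : n0 + 2 ≤ m)
            push_cast
            rw [abs_of_nonneg (by linarith), abs_of_nonneg (by linarith)]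
            linarith
    · push Not at hA8
      have hn00 : n0 = 0 := by
        have g1 : (n0 : ℝ) < 1 := by linarith
        have g2 : (0 : ℝ) < n0 + 1 := by linarith
        have g1' : n0 < 1 := by exact_mod_cast g1
        have g2' : 0 < n0 + 1 := by exact_mod_cast g2
        omega
      apply hgood m (by rw [hn00]; exact hm)
      rw [hn00]
      rcases lt_or_gt_of_ne hm with h3 | h3
      · have h4 : (m : ℝ) ≤ - 1 := by exact_mod_cast (by omega : m ≤ - 1)
        push_cast
        rw [abs_of_nonpos (by linarith), abs_of_nonpos (by linarith)]
        linarith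
      · have h4 : (1 : ℝ) ≤ m := by exact_mod_cast (by omega : 1 ≤ m)
        push_cast
        rw [abs_of_nonneg (by linarith), abs_of_nonneg (by linarith)]
        linarith
  obtain ⟨s1, t1⟩ := zprof_sum (σ / 2) (by positivity)
  obtain ⟨s2, t2⟩ := zprof_sum (ν * σ / 2) (by positivity)
  have S1 := zprof_shift (σ / 2) n0 s1
  have S2 := zprof_shift (ν * σ / 2) n0 s2
  have S3 : HasSum D _ := ((((S1.mul_left (1 / ν)).add S2).mul_left (600 * B)).add
    ((hasSum_ite_eq n0 T).add (hasSum_ite_eq (n0 + 1) T))).mul_left M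
  have hnorm : ∀ m, ‖f m‖ ≤ D m := by
    intro m
    by_cases hm : m = 0
    · rw [hm, hf0, norm_zero]
      exact mul_nonneg hM (add_nonneg (hz0 0) (add_nonneg (hite _ _) (hite _ _)))
    · exact (hfm m hm).trans (mul_le_mul_of_nonneg_left (hpt m hm) hM)
  have hfin := tsum_of_norm_bounded S3 hnorm
  rw [hf.tsum_eq] at hfin
  refine hfin.trans (mul_le_mul_of_nonneg_left ?_ hM)
  have e1 : 600 * B * (1 / ν * (4 / (σ / 2)) + 4 / (ν * σ / 2)) = 19200 * B * A / (ν * K) := by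
    rw [hσ]; field_simp; ring
  have h6 : 600 * B * (1 / ν * (∑' m, zprof (σ / 2) m) + ∑' m, zprof (ν * σ / 2) m) ≤ 19200 * B * A / (ν * K) := by
    rw [← e1]
    exact mul_le_mul_of_nonneg_left (add_le_add (mul_le_mul_of_nonneg_left t1 (by positivity)) t2) (by positivity)
  linarith

lemma err_hasSum {s : ℝ} {η : ℝ → ℝ} {N q : ℕ} {h K B : ℝ} (ha : Adm B (amp s η K⁻¹)) (hK : 0 < K)
    (hN : 0 < (N : ℝ)) (hq1 : 1 ≤ q) (hh : 0 < h) (p : ℤ) :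
    HasSum (fun m : ℤ => if m = 0 then 0 else (1 / (q : ℂ)) * gaussTau p q m * ((((N : ℝ) ^ (1 - s) * K⁻¹ : ℝ) : ℂ) *
      Complex.exp (-(Complex.I * π * (m : ℂ) ^ 2 / (2 * (q : ℂ) ^ 2 * h))) *
        Ism (amp s η K⁻¹) (N ^ 2 * h * K⁻¹ ^ 2) (cM N q h K m)))
      (FphiN s (fun t => ((η (K * (t - 1)) : ℝ) : ℂ)) N ((p : ℝ) / q + h) -
        gaussTheta p q 0 * ((((N : ℝ) ^ (1 - s) : ℝ)) : ℂ) / (Real.sqrt q : ℂ) *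
          (∫ t : ℝ, Complex.exp (2 * Real.pi * Complex.I * (N : ℂ) ^ 2 * (h : ℂ) * (t : ℂ) ^ 2) *
            (((t ^ (-s) : ℝ)) : ℂ) * ((η (K * (t - 1)) : ℝ) : ℂ)) -
        GphiN s (fun t => ((η (K * (t - 1)) : ℝ) : ℂ)) p q N h) := by
  have hq : 0 < (q : ℝ) := by exact_mod_cast hq1
  rw [main_ident hK hN hq, F_ident ha hK hN]
  have h1 := twisted_poisson p q hq1 (fP s η N h K) (fP_smooth ha) (fP_compact ha hK hN)
  have h2 := G_ident ha hK hN hq hh p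
  set P0 := (1 / (q : ℂ)) * gaussTau p q 0 *
        ∫ y : ℝ, fP s η N h K y * Complex.exp (-(2 * π * Complex.I * (0 : ℤ) * y / q)) with hP0
  have h3 := (h1.sub (hasSum_ite_eq (0 : ℤ) P0)).sub h2
  refine Eq.mpr (congrArg (fun f : ℤ → ℂ => HasSum f _) (funext fun m => ?_)) h3
  by_cases hm : m = 0
  · subst hm
    rw [if_pos rfl, if_pos rfl, amp_cM_zero ha hK hN hq hh le_rfl, hP0]
    simp
  · rw [if_neg hm, if_neg hm, int_ident hK hN hq hh m]
    unfold Ism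
    ring


lemma final_calc (B q N h K s Γ : ℝ) (hB : 0 ≤ B) (hq : 0 < q) (hN : 0 < N) (hh : 0 < h) (hK : 0 < K)
    (hΓ : 0 ≤ Γ) (T : ℝ)
    (hT : T = if 1 / 8 ≤ N * h * q then 32 * B * (1 / √(N ^ 2 * h * K⁻¹ ^ 2)) * Γ else 0) :
    (1 / q * √(2 * q) * (N ^ (1 - s) * K⁻¹)) *
        (19200 * B * (N * h * q) / ((N ^ 2 * h * K⁻¹ ^ 2) * K) + 2 * T) ≤
      (40000 * B + 8) * (√q * N ^ (-s) + N ^ (1/2 - s) * Γ) := by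
  have e1 : N ^ (1 - s) = N * N ^ (-s) := by
    rw [sub_eq_add_neg, Real.rpow_add hN, Real.rpow_one]
  have e2 : N ^ (1/2 - s) = √N * N ^ (-s) := by
    rw [sub_eq_add_neg, Real.rpow_add hN, Real.sqrt_eq_rpow]
  have e3 : √(2 * q) = √2 * √q := Real.sqrt_mul (by norm_num) q
  have e4 : √(N ^ 2 * h * K⁻¹ ^ 2) = N * K⁻¹ * √h := by
    rw [show N ^ 2 * h * K⁻¹ ^ 2 = (N * K⁻¹) ^ 2 * h by ring, Real.sqrt_mul (by positivity),
      Real.sqrt_sq (by positivity)]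
  have h2 : √2 ≤ 2 := by
    rw [Real.sqrt_le_left (by norm_num)]; norm_num
  have hZ : 0 < N ^ (-s) := by positivity
  rw [e1, e2, e3, hT, e4, mul_add]
  generalize N ^ (-s) = Z at *
  have hsq : 0 < √q := Real.sqrt_pos.2 hq
  have hsh : 0 < √h := Real.sqrt_pos.2 hh
  have hsN : 0 < √N := Real.sqrt_pos.2 hN
  have qq : √q * √q = q := Real.mul_self_sqrt hq.le
  have a1 : 1 / q * (√2 * √q) * (N * Z * K⁻¹) * (19200 * B * (N * h * q) / ((N ^ 2 * h * K⁻¹ ^ 2) * K)) =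
      (19200 * √2 * B) * (√q * Z) := by
    field_simp
  have a2 : (19200 * √2 * B) * (√q * Z) ≤ (40000 * B + 8) * (√q * Z) := by
    apply mul_le_mul_of_nonneg_right _ (by positivity)
    nlinarith
  have a3 : 1 / q * (√2 * √q) * (N * Z * K⁻¹) * (2 * (if 1 / 8 ≤ N * h * q then 32 * B * (1 / (N * K⁻¹ * √h)) * Γ else 0)) ≤
      (40000 * B + 8) * (√N * Z * Γ) := by
    split_ifs with hA
    · have b1 : 1 / q * (√2 * √q) * (N * Z * K⁻¹) * (2 * (32 * B * (1 / (N * K⁻¹ * √h)) * Γ)) =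
          (64 * √2 * B) * ((1 / (√q * √h)) * (Z * Γ)) := by
        have : 1 / q * √q = 1 / √q := by
          rw [← qq]; rw [Real.sqrt_mul_self hsq.le]; field_simp
        rw [show 1 / q * (√2 * √q) = √2 * (1 / q * √q) by ring, this]
        field_simp
        ring
      have b2 : 1 / (√q * √h) ≤ 3 * √N := by
        rw [div_le_iff₀ (by positivity)]
        have : √(1/9) ≤ √(N * h * q) := Real.sqrt_le_sqrt (by linarith)
        rw [Real.sqrt_mul (by positivity), Real.sqrt_mul (by positivity),
          show (1/9 : ℝ) = (1/3) ^ 2 by norm_num, Real.sqrt_sq (by norm_num)] at this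
        nlinarith
      rw [b1]
      calc (64 * √2 * B) * ((1 / (√q * √h)) * (Z * Γ)) ≤ (64 * 2 * B) * ((3 * √N) * (Z * Γ)) := by
            gcongr
        _ = 384 * B * (√N * Z * Γ) := by ring
        _ ≤ _ := by
            apply mul_le_mul_of_nonneg_right _ (by positivity)
            linarith
    · simp only [mul_zero]; positivity
  rw [a1]
  calc _ ≤ _ := add_le_add a2 a3
    _ = _ := by ring


/-- Lemma 3.9. Let `s ∈ (1/2,1]` and let `η` be `C^∞`, supported in
`[1/2,2]`, with `η(t) = 1 - η(t/2)` for `1 ≤ t ≤ 2`; set `η^k(t) = η(2^k(t-1))`. There is a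
constant `C > 0`, depending only on `η` and `s`, such that for all coprime `p, q` with
`q ≥ 1`, all `N ≥ q` and all `0 < h ≤ 1`, there are nonnegative reals `(γ_k)_{k≥2}` with
`∑_{k≥2} γ_k ≤ C` such that for every `k ≥ 2`:
`|F^{η^k}_{s,N}(p/q+h) - (θ_0 N^{1-s}/√q) ∫ e^{2πiN²ht²} t^{-s} η^k(t) dt - G^{η^k}_{s,N}(h)|
  ≤ C (√q N^{-s} + N^{1/2-s} γ_k)`. -/
theorem summation_formula_etak_all_k (s : ℝ) (hs : s ∈ Set.Ioc (1/2 : ℝ) 1)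
    (η : ℝ → ℝ) (hη : ContDiff ℝ (⊤ : ℕ∞) η) (hsupp : tsupport η ⊆ Set.Icc (1/2 : ℝ) 2)
    (hpart : ∀ t ∈ Set.Icc (1 : ℝ) 2, η t = 1 - η (t / 2)) :
    ∃ C : ℝ, 0 < C ∧
      ∀ (p : ℤ) (q : ℕ), 1 ≤ q → IsCoprime p (q : ℤ) →
        ∀ N : ℕ, q ≤ N → ∀ h : ℝ, 0 < h → h ≤ 1 →
          ∃ γ : ℕ → ℝ, (∀ k, 0 ≤ γ k) ∧ (Summable γ) ∧ (∑' k, γ k) ≤ C ∧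
            ∀ k : ℕ, 2 ≤ k →
              ‖FphiN s (fun t => ((η (2 ^ k * (t - 1)) : ℝ) : ℂ)) N ((p : ℝ) / q + h) -
                  gaussTheta p q 0 * ((((N : ℝ) ^ (1 - s) : ℝ)) : ℂ) / (Real.sqrt q : ℂ) *
                    (∫ t : ℝ,
                      Complex.exp (2 * Real.pi * Complex.I * (N : ℂ) ^ 2 * (h : ℂ) * (t : ℂ) ^ 2) *
                        (((t ^ (-s) : ℝ)) : ℂ) * ((η (2 ^ k * (t - 1)) : ℝ) : ℂ)) -
                  GphiN s (fun t => ((η (2 ^ k * (t - 1)) : ℝ) : ℂ)) p q N h‖ ≤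
                C * (Real.sqrt q * (N : ℝ) ^ (-s) + (N : ℝ) ^ (1/2 - s) * γ k) := by
  obtain ⟨B, hB⟩ := amp_adm s η hη hsupp
  have hB0 : 0 ≤ B := (hB 0 le_rfl zero_le_one).B_nonneg
  refine ⟨40000 * B + 8, by positivity, ?_⟩
  intro p q hq1 hpq N hqN h hh _
  have hq : (0 : ℝ) < q := by exact_mod_cast hq1
  have hN : (0 : ℝ) < N := by exact_mod_cast (by omega : 0 < N)
  set n0 : ℤ := ⌊2 * ((N : ℝ) * h * q)⌋ with hn0
  have hn1 : (n0 : ℝ) ≤ 2 * ((N : ℝ) * h * q) := Int.floor_le _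
  have hn2 : 2 * ((N : ℝ) * h * q) < (n0 : ℝ) + 1 := Int.lt_floor_add_one _
  clear_value n0
  have hA : 0 < (N : ℝ) * h * q := by positivity
  have hx : 0 < 1 / √((N : ℝ) ^ 2 * h) := by positivity
  have hy : 0 < ((n0 : ℝ) + 1) / (2 * ((N : ℝ) * h * q)) - 1 := by
    rw [sub_pos, one_lt_div (by positivity)]; exact hn2
  refine ⟨fun k => gmin (2 ^ k * (1 / √((N : ℝ) ^ 2 * h))) +
    gmin (2 ^ k * (((n0 : ℝ) + 1) / (2 * ((N : ℝ) * h * q)) - 1)), ?_, ?_, ?_, ?_⟩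
  · intro k
    exact add_nonneg (gmin_nonneg (by positivity)) (gmin_nonneg (by positivity))
  · exact (gmin_summable hx).add (gmin_summable hy)
  · rw [(gmin_summable hx).tsum_add (gmin_summable hy)]
    linarith [gmin_tsum_le hx, gmin_tsum_le hy]
  · intro k _
    beta_reduce
    have hK : (0 : ℝ) < 2 ^ k := by positivity
    have hK1 : ((2 : ℝ) ^ k)⁻¹ ≤ 1 := inv_le_one_of_one_le₀ (one_le_pow₀ (by norm_num))
    have ha := hB ((2 : ℝ) ^ k)⁻¹ (by positivity) hK1
    generalize (2 : ℝ) ^ k = K at *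
    have hΓ : 0 ≤ gmin (K * (1 / √((N : ℝ) ^ 2 * h))) +
        gmin (K * (((n0 : ℝ) + 1) / (2 * ((N : ℝ) * h * q)) - 1)) :=
      add_nonneg (gmin_nonneg (by positivity)) (gmin_nonneg (by positivity))
    have hr : 1 / √((N : ℝ) ^ 2 * h * K⁻¹ ^ 2) = K * (1 / √((N : ℝ) ^ 2 * h)) := by
      rw [Real.sqrt_mul (by positivity), Real.sqrt_sq (by positivity)]
      field_simp
    have hcm : ∀ m : ℤ, cM N q h K m = K * ((m : ℝ) / (2 * ((N : ℝ) * h * q)) - 1) := by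
      intro m; unfold cM
      rw [show 2 * (N : ℝ) * h * q = 2 * ((N : ℝ) * h * q) by ring]
    generalize hT : (if 1 / 8 ≤ (N : ℝ) * h * q then
      32 * B * (1 / √((N : ℝ) ^ 2 * h * K⁻¹ ^ 2)) * (gmin (K * (1 / √((N : ℝ) ^ 2 * h))) +
        gmin (K * (((n0 : ℝ) + 1) / (2 * ((N : ℝ) * h * q)) - 1))) else 0) = T
    have hT0 : 0 ≤ T := by
      rw [← hT]; split_ifs
      · positivity
      · exact le_rfl
    refine le_trans (ism_sum ha ((N : ℝ) ^ 2 * h * K⁻¹ ^ 2) ((N : ℝ) * h * q) K (by positivity) hA hK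
      (cM N q h K) hcm ?_ T hT0 n0 hn1 hn2 ?_ _ _ (err_hasSum ha hK hN hq1 hh p)
      (1 / q * √(2 * q) * ((N : ℝ) ^ (1 - s) * K⁻¹)) (by positivity) ?_ ?_)
      (final_calc B q N h K s _ hB0 hq hN hh hK hΓ T hT.symm)
    · intro m hm
      apply ha.zero
      intro h1
      linarith [h1.1]
    · intro h8
      rw [← hT, if_pos h8, hcm, ← hr]
      push_cast
      exact le_rfl
    · simp
    · intro m hm
      rw [if_neg hm, norm_mul, norm_mul, norm_mul, norm_mul]
      have g1 : ‖(1 / (q : ℂ))‖ = 1 / q := by simp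
      have g2 : ‖gaussTau p q m‖ ≤ √(2 * q) := Real.le_sqrt_of_sq_le (gaussTau_norm_sq p q hq1 hpq m)
      have g3 : ‖(((N : ℝ) ^ (1 - s) * K⁻¹ : ℝ) : ℂ)‖ = (N : ℝ) ^ (1 - s) * K⁻¹ := by
        rw [Complex.norm_real, Real.norm_of_nonneg (by positivity)]
      have g4 : ‖Complex.exp (-(Complex.I * π * (m : ℂ) ^ 2 / (2 * (q : ℂ) ^ 2 * h)))‖ = 1 :=
        norm_cexp_I _ (-(π * m ^ 2 / (2 * q ^ 2 * h))) (by push_cast; ring)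
      rw [g1, g3, g4, mul_one, ← mul_assoc]
      gcongr
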